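/- Let d ≥ 2. For all p_c(d) < p ≤ q ≤ 1 and all x ∈ ℤ^d, the time constants satisfy μ_p(x) ≥ μ_q(x). -/

import Mathlib

open MeasureTheory Filter Topology
open scoped ENNReal

namespace Perco

/-- Vertices of the hypercubic lattice `ℤ^d`. -/
abbrev V (d : ℕ) := Fin d → ℤ

/-- The `ℓ¹` distance on `ℤ^d`. -/
def dist1 {d : ℕ} (x y : V d) : ℕ := ∑ i, (x i - y i).natAbs

/-- The `ℓ¹` norm, as a real number. -/
def norm1 {d : ℕ} (x : V d) : ℝ := (dist1 x 0 : ℝ)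

/-- The `ℓ¹` distance, descended to unordered pairs. -/
def sym2dist1 {d : ℕ} : Sym2 (V d) → ℕ :=
  Sym2.lift ⟨fun x y => dist1 x y, fun x y => by
    unfold dist1
    exact Finset.sum_congr rfl fun i _ => by rw [← Int.natAbs_neg, neg_sub]⟩

/-- Edges of the lattice `(ℤ^d, 𝔼^d)`: unordered pairs of nearest neighbours. -/
def Edge (d : ℕ) : Type := {e : Sym2 (V d) // sym2dist1 e = 1}

/-- A bond percolation configuration: every edge is open (`true`) or closed (`false`). -/
abbrev Config (d : ℕ) := Edge d → Bool

/-- The unordered pair `e` is an open edge of the configuration `ω`. -/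
def openE {d : ℕ} (ω : Config d) (e : Sym2 (V d)) : Prop :=
  ∃ h : sym2dist1 e = 1, ω ⟨e, h⟩ = true

/-- `⟨x, y⟩` is an open edge of the configuration `ω`. -/
def edgeOpen {d : ℕ} (ω : Config d) (x y : V d) : Prop := openE ω s(x, y)

/-- `f 0, f 1, …, f n` is an `ω`-open path (with `n` edges). -/
def IsOpenPath {d : ℕ} (ω : Config d) (n : ℕ) (f : ℕ → V d) : Prop :=
  ∀ i < n, edgeOpen ω (f i) (f (i + 1))

/-- `f 0, …, f n` is a (not necessarily open) lattice path of `ℤ^d`. -/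
def IsLatticePath {d : ℕ} (n : ℕ) (f : ℕ → V d) : Prop :=
  ∀ i < n, dist1 (f i) (f (i + 1)) = 1

/-- The chemical distance between `x` and `y` in the configuration `ω`:
the minimal number of edges of an `ω`-open path from `x` to `y` (`⊤` if there is none). -/
noncomputable def chemDist {d : ℕ} (ω : Config d) (x y : V d) : ℝ≥0∞ :=
  sInf {r : ℝ≥0∞ | ∃ (n : ℕ) (f : ℕ → V d),
    IsOpenPath ω n f ∧ f 0 = x ∧ f n = y ∧ r = (n : ℝ≥0∞)}

/-- `x` and `y` are connected by an `ω`-open path. -/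
def Connected {d : ℕ} (ω : Config d) (x y : V d) : Prop := chemDist ω x y ≠ ⊤

/-- The open cluster of the vertex `x`. -/
def cluster {d : ℕ} (ω : Config d) (x : V d) : Set (V d) := {y | Connected ω x y}

/-- `x` lies in an infinite open cluster. -/
def InInfiniteCluster {d : ℕ} (ω : Config d) (x : V d) : Prop := (cluster ω x).Infinite

open Classical in
/-- The regularized point `x̃`: a point of the infinite cluster minimizing the `ℓ¹`
distance to `x` (with a deterministic rule to break ties); `x` itself if there is none. -/
noncomputable def regPoint {d : ℕ} (ω : Config d) (x : V d) : V d :=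
  if h : ∃ y : V d, InInfiniteCluster ω y ∧
      ∀ z : V d, InInfiniteCluster ω z → dist1 x y ≤ dist1 x z
  then h.choose else x

/-- Real-valued chemical distance (in the configuration `ωdist`) between the
regularizations (w.r.t. the configuration `ωreg`) of `x` and `y`. -/
noncomputable def DReg {d : ℕ} (ωdist ωreg : Config d) (x y : V d) : ℝ :=
  (chemDist ωdist (regPoint ωreg x) (regPoint ωreg y)).toReal

open Classical in
/-- The number of elements of a set, as an element of `ℝ≥0∞` (`⊤` for infinite sets). -/
noncomputable def eSize {α : Type*} (A : Set α) : ℝ≥0∞ :=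
  if h : A.Finite then (h.toFinset.card : ℝ≥0∞) else ⊤

/-!  ### Boxes and renormalization  -/

/-- The box of "radius" `R` centered at `c`: `∏ₖ [c k - R, c k + R)`. -/
def boxC {d : ℕ} (c : V d) (R : ℕ) : Set (V d) :=
  {x | ∀ k, c k - (R : ℤ) ≤ x k ∧ x k < c k + (R : ℤ)}

/-- The center `i(2N+1)` of the `N`-box of macroscopic index `i`. -/
def center {d : ℕ} (N : ℕ) (i : V d) : V d := fun k => i k * (2 * (N : ℤ) + 1)

/-- The `N`-box `B_N(i) = i(2N+1) + [-N, N)^d`. -/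
def macroBox {d : ℕ} (N : ℕ) (i : V d) : Set (V d) := boxC (center N i) N

/-- The enlarged box `B'_N(i) = i(2N+1) + [-3N, 3N)^d`. -/
def macroBox' {d : ℕ} (N : ℕ) (i : V d) : Set (V d) := boxC (center N i) (3 * N)

/-- An open path all of whose vertices stay in the set `S`. -/
def IsOpenPathIn {d : ℕ} (ω : Config d) (S : Set (V d)) (n : ℕ) (f : ℕ → V d) : Prop :=
  IsOpenPath ω n f ∧ ∀ i ≤ n, f i ∈ S

/-- `x` and `y` are connected by an open path inside `S`. -/
def ConnectedIn {d : ℕ} (ω : Config d) (S : Set (V d)) (x y : V d) : Prop :=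
  ∃ (n : ℕ) (f : ℕ → V d), IsOpenPathIn ω S n f ∧ f 0 = x ∧ f n = y

/-- The open cluster of `x` inside the set `S`. -/
def clusterIn {d : ℕ} (ω : Config d) (S : Set (V d)) (x : V d) : Set (V d) :=
  {y | ConnectedIn ω S x y}

/-- `C` is an open cluster of the region `S`. -/
def IsClusterIn {d : ℕ} (ω : Config d) (S : Set (V d)) (C : Set (V d)) : Prop :=
  ∃ x ∈ S, C = clusterIn ω S x

/-- The cluster `C` has diameter at least `m`. -/
def diamGE {d : ℕ} (C : Set (V d)) (m : ℕ) : Prop :=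
  ∃ x ∈ C, ∃ y ∈ C, ∃ k, (m : ℤ) ≤ |x k - y k|

/-- The cluster `C` is crossing for the box `boxC c R`: for each of the `d` directions,
`C ∩ boxC c R` contains an open path connecting the two opposite faces of the box. -/
def CrossingFor {d : ℕ} (ω : Config d) (C : Set (V d)) (c : V d) (R : ℕ) : Prop :=
  ∀ k : Fin d, ∃ (n : ℕ) (f : ℕ → V d), IsOpenPath ω n f ∧
    (∀ m ≤ n, f m ∈ C ∩ boxC c R) ∧ f 0 k = c k - (R : ℤ) ∧ f n k = c k + (R : ℤ) - 1

/-- The `N`-box `B_N(i)` is good (for the configuration `ω`, with parameter `β`):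
(i) there is a unique open cluster `C` of `B'_N(i)` of diameter at least `N`;
(ii) `C` is crossing for each of the `3^d` `N`-boxes included in `B'_N(i)`;
(iii) any two points of `C ∩ B'_N(i)` are at chemical distance at most `12βN`. -/
def IsGoodBox {d : ℕ} (ω : Config d) (N : ℕ) (β : ℝ) (i : V d) : Prop :=
  ∃ C : Set (V d),
    IsClusterIn ω (macroBox' N i) C ∧ diamGE C N ∧
    (∀ C', IsClusterIn ω (macroBox' N i) C' → diamGE C' N → C' = C) ∧
    (∀ j : V d, (∀ k, |j k - i k| ≤ 1) → CrossingFor ω C (center N j) N) ∧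
    (∀ x ∈ macroBox' N i, ∀ y ∈ macroBox' N i, x ∈ C → y ∈ C →
      chemDist ω x y ≤ ENNReal.ofReal (12 * β * N))

/-- `x` belongs to the crossing cluster of the good box `B_N(j)`, i.e. to a cluster of
`B'_N(j)` of diameter at least `N`. -/
def InCrossingCluster {d : ℕ} (ω : Config d) (N : ℕ) (j : V d) (x : V d) : Prop :=
  ∃ C : Set (V d), IsClusterIn ω (macroBox' N j) C ∧ diamGE C N ∧ x ∈ C

/-!  ### Macroscopic site percolation -/

/-- A nearest-neighbour path of macroscopic sites staying in `S`. -/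
def IsSitePathIn {d : ℕ} (S : Set (V d)) (n : ℕ) (f : ℕ → V d) : Prop :=
  (∀ m ≤ n, f m ∈ S) ∧ ∀ m < n, dist1 (f m) (f (m + 1)) = 1

/-- The sites `i` and `j` are connected by a nearest-neighbour path inside `S`. -/
def SiteConnectedIn {d : ℕ} (S : Set (V d)) (i j : V d) : Prop :=
  ∃ (n : ℕ) (f : ℕ → V d), IsSitePathIn S n f ∧ f 0 = i ∧ f n = j

/-- A `*`-path of macroscopic sites staying in `S` (consecutive sites are `*`-neighbours:
their `ℓ^∞` distance is `1`). -/
def IsStarPathIn {d : ℕ} (S : Set (V d)) (n : ℕ) (f : ℕ → V d) : Prop :=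
  (∀ m ≤ n, f m ∈ S) ∧ ∀ m < n, f m ≠ f (m + 1) ∧ ∀ k, |f (m + 1) k - f m k| ≤ 1

/-- The set of good macroscopic sites. -/
def goodSites {d : ℕ} (ω : Config d) (N : ℕ) (β : ℝ) : Set (V d) :=
  {i | IsGoodBox ω N β i}

/-- The macroscopic site `i` belongs to an infinite cluster of good boxes. -/
def InInfiniteGoodCluster {d : ℕ} (ω : Config d) (N : ℕ) (β : ℝ) (i : V d) : Prop :=
  IsGoodBox ω N β i ∧ {j | SiteConnectedIn (goodSites ω N β) i j}.Infinite

/-- The union of the bad connected components (of the macroscopic site percolation)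
meeting the set `Γ`; its size is `Σ_{C ∈ Bad, C ∩ Γ ≠ ∅} |C|`. -/
def badTouching {d : ℕ} (ω : Config d) (N : ℕ) (β : ℝ) (Γ : Set (V d)) : Set (V d) :=
  {j | ∃ i ∈ Γ, i ∉ goodSites ω N β ∧ SiteConnectedIn {k | k ∉ goodSites ω N β} i j}

/-!  ### Edges and sites of a path -/

/-- The set of edges of the path `f 0, …, f n`. -/
def pathEdges {d : ℕ} (n : ℕ) (f : ℕ → V d) : Set (Sym2 (V d)) :=
  {e | ∃ i < n, e = s(f i, f (i + 1))}

/-- The set of vertices of the path `f 0, …, f n`. -/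
def pathVerts {d : ℕ} (n : ℕ) (f : ℕ → V d) : Set (V d) :=
  {v | ∃ i ≤ n, f i = v}

/-- The set of `ω`-closed edges of the path `f 0, …, f n`. -/
def closedEdges {d : ℕ} (ω : Config d) (n : ℕ) (f : ℕ → V d) : Set (Sym2 (V d)) :=
  {e | e ∈ pathEdges n f ∧ ¬ openE ω e}

/-- The set `Γ` of macroscopic sites whose `N`-box is visited by the path `f 0, …, f n`. -/
def visitedSites {d : ℕ} (N : ℕ) (n : ℕ) (f : ℕ → V d) : Set (V d) :=
  {i | ∃ m ≤ n, f m ∈ macroBox N i}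

/-!  ### Probability: i.i.d. Bernoulli bond percolation -/

/-- A family of i.i.d. Bernoulli bond percolation measures on the configurations:
`P p` is a probability measure under which the states of the edges are independent
Bernoulli variables of parameter `p`. -/
structure BernoulliFamily (d : ℕ) where
  P : ℝ → Measure (Config d)
  prob : ∀ p, IsProbabilityMeasure (P p)
  iid : ∀ p, 0 ≤ p → p ≤ 1 → ∀ (s : Finset (Edge d)) (f : Edge d → Bool),
    P p {ω : Config d | ∀ e ∈ s, ω e = f e}
      = ∏ e ∈ s, ENNReal.ofReal (if f e then p else 1 - p)

/-- The critical parameter `p_c(d)` of the family. -/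
noncomputable def pc {d : ℕ} (F : BernoulliFamily d) : ℝ :=
  sInf {p : ℝ | 0 ≤ p ∧ p ≤ 1 ∧ 0 < F.P p {ω : Config d | InInfiniteCluster ω 0}}

/-- `t` is the time constant of the percolation measure `P`: for every `x ∈ ℤ^d`,
`D^{𝒞}(0̃, ñx)/n → t x` almost surely. -/
def ASTimeConstant {d : ℕ} (P : Measure (Config d)) (t : V d → ℝ) : Prop :=
  ∀ x : V d, ∀ᵐ ω ∂P, Tendsto (fun n : ℕ => DReg ω ω 0 (n • x) / n) atTop (𝓝 (t x))

/-!  ### Couplings -/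

/-- Two-stage coupling configurations: each edge carries a pair `(V, Z)` of Booleans. -/
abbrev CConfig (d : ℕ) := Edge d → Bool × Bool

/-- The `q`-configuration of a coupled configuration: `e` is `q`-open iff `V e = 1`. -/
def cfgQ {d : ℕ} (u : CConfig d) : Config d := fun e => (u e).1

/-- The `p`-configuration of a coupled configuration: `e` is `p`-open iff `V e Z e = 1`. -/
def cfgP {d : ℕ} (u : CConfig d) : Config d := fun e => (u e).1 && (u e).2

/-- Two-stage coupling of the `p`- and `q`-percolations: on each edge, independently,
`V` is Bernoulli of parameter `q` and `Z` is an independent Bernoulli of parameter `p/q`. -/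
structure CouplingMeasure (d : ℕ) (p q : ℝ) where
  Q : Measure (CConfig d)
  prob : IsProbabilityMeasure Q
  iid : ∀ (s : Finset (Edge d)) (f : Edge d → Bool × Bool),
    Q {u : CConfig d | ∀ e ∈ s, u e = f e}
      = ∏ e ∈ s,
          (ENNReal.ofReal (if (f e).1 then q else 1 - q) *
            ENNReal.ofReal (if (f e).2 then p / q else 1 - p / q))

/-- Standard coupling: i.i.d. uniform variables on `[0,1]`, one for each edge. -/
structure UniformCoupling (d : ℕ) where
  Q : Measure (Edge d → ℝ)
  prob : IsProbabilityMeasure Q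
  iid : ∀ (s : Finset (Edge d)) (a : Edge d → ℝ), (∀ e ∈ s, 0 ≤ a e ∧ a e ≤ 1) →
    Q {u | ∀ e ∈ s, u e ≤ a e} = ∏ e ∈ s, ENNReal.ofReal (a e)

open Classical in
/-- The `p`-configuration of the standard coupling: `e` is `p`-open iff `U e ≤ p`. -/
noncomputable def cfgAt {d : ℕ} (u : Edge d → ℝ) (p : ℝ) : Config d :=
  fun e => if u e ≤ p then true else false

/-- The critical parameter `p_c(d)` read on the standard coupling. -/
noncomputable def pcU {d : ℕ} (U : UniformCoupling d) : ℝ :=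
  sInf {p : ℝ | 0 ≤ p ∧ p ≤ 1 ∧ 0 < U.Q {u | InInfiniteCluster (cfgAt u p) 0}}

open Classical in
/-- A deterministically chosen geodesic (open path of minimal length) from `x` to `y`
in the configuration `ω` (a trivial constant path if there is none). -/
noncomputable def geod {d : ℕ} (ω : Config d) (x y : V d) : ℕ × (ℕ → V d) :=
  if h : ∃ nf : ℕ × (ℕ → V d), IsOpenPath ω nf.1 nf.2 ∧ nf.2 0 = x ∧ nf.2 nf.1 = y ∧
      (nf.1 : ℝ≥0∞) = chemDist ω x y
  then h.choose else (0, fun _ => x)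

/-!  ### Norms on `ℝ^d` -/

/-- `f` is a norm on the Euclidean space `ℝ^d`. -/
def IsNorm {d : ℕ} (f : EuclideanSpace ℝ (Fin d) → ℝ) : Prop :=
  (∀ x, 0 ≤ f x) ∧ (∀ x, f x = 0 ↔ x = 0) ∧
  (∀ (c : ℝ) (x), f (c • x) = |c| * f x) ∧ ∀ x y, f (x + y) ≤ f x + f y

/-- The canonical embedding of `ℤ^d` into the Euclidean space `ℝ^d`. -/
noncomputable def toEuc {d : ℕ} (x : V d) : EuclideanSpace ℝ (Fin d) :=
  (WithLp.equiv 2 (Fin d → ℝ)).symm fun i => (x i : ℝ)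

/-- Property (1) of the path-modification lemma: the edges of `γ' \ γ` decompose as a
disjoint union of self-avoiding `p`-open paths intersecting `γ' ∩ γ` at their endpoints. -/
def DisjointPathDecomposition {d : ℕ} (ωp : Config d) (n : ℕ) (f : ℕ → V d)
    (n' : ℕ) (g : ℕ → V d) : Prop :=
  ∃ (K : ℕ) (m : ℕ → ℕ) (h : ℕ → ℕ → V d),
    (⋃ j ∈ Finset.range K, pathEdges (m j) (h j)) = pathEdges n' g \ pathEdges n f ∧
    (∀ j < K, IsOpenPath ωp (m j) (h j)) ∧
    (∀ j < K, ∀ a ≤ m j, ∀ b ≤ m j, h j a = h j b → a = b) ∧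
    (∀ j < K, ∀ l < K, j ≠ l → Disjoint (pathEdges (m j) (h j)) (pathEdges (m l) (h l))) ∧
    (∀ j < K, h j 0 ∈ pathVerts n f ∧ h j (m j) ∈ pathVerts n f) ∧
    (∀ j < K, ∀ a, 0 < a → a < m j → h j a ∉ pathVerts n f)

/-- The conclusion of the path-modification lemma, for the constant `ρ`:
any `q`-open path between well-connected points of `𝒞_p` can be turned into a `p`-open
path, the total length of the bypasses being controlled by the bad clusters met and the
number of `p`-closed edges. -/
def BypassProperty (d : ℕ) (ρ : ℕ) : Prop :=
  ∀ (N : ℕ), 1 ≤ N → ∀ (β : ℝ), 1 ≤ β → ∀ (ωp ωq : Config d),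
    (∀ e, ωp e = true → ωq e = true) →
    ∀ y z : V d, InInfiniteCluster ωp y → InInfiniteCluster ωp z →
    (∃ i, y ∈ macroBox N i ∧ InInfiniteGoodCluster ωp N β i) →
    (∃ i, z ∈ macroBox N i ∧ InInfiniteGoodCluster ωp N β i) →
    ∀ (n : ℕ) (f : ℕ → V d), IsOpenPath ωq n f → f 0 = y → f n = z →
    ∃ (n' : ℕ) (g : ℕ → V d), IsOpenPath ωp n' g ∧ g 0 = y ∧ g n' = z ∧
      DisjointPathDecomposition ωp n f n' g ∧
      eSize (pathEdges n' g \ pathEdges n f) ≤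
        ((ρ * N : ℕ) : ℝ≥0∞) *
          (eSize (badTouching ωp N β (visitedSites N n f)) + eSize (closedEdges ωp n f))


/-! ### A finite-graph estimate (Aizenman–Kesten–Newman, Gandolfi–Grimmett–Russo) -/

section Finite

variable {X E : Type*} (s t : E → X)

/-- One open step. -/
def gstep (η : E → Bool) (u v : X) : Prop :=
  ∃ e, η e = true ∧ ((s e = u ∧ t e = v) ∨ (s e = v ∧ t e = u))

/-- Connection in the finite graph. -/
def gconn (η : E → Bool) : X → X → Prop := Relation.ReflTransGen (gstep s t η)

theorem gconn_refl (η : E → Bool) (u : X) : gconn s t η u u := Relation.ReflTransGen.refl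

theorem gconn_trans {η : E → Bool} {u v w : X} (h : gconn s t η u v) (h' : gconn s t η v w) :
    gconn s t η u w := Relation.ReflTransGen.trans h h'

theorem gconn_symm {η : E → Bool} {u v : X} (h : gconn s t η u v) : gconn s t η v u := by
  induction h with
  | refl => exact gconn_refl s t η _
  | tail _ hstep ih =>
    obtain ⟨e, he, h⟩ := hstep
    exact Relation.ReflTransGen.head ⟨e, he, h.symm⟩ ih

theorem gconn_edge {η : E → Bool} {e : E} (he : η e = true) : gconn s t η (s e) (t e) :=
  Relation.ReflTransGen.single ⟨e, he, Or.inl ⟨rfl, rfl⟩⟩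

/-- The cluster of `b`. -/
def gcl (η : E → Bool) (b : X) : Set X := {v | gconn s t η b v}

theorem gcl_eq_of_mem {η : E → Bool} {b v : X} (h : v ∈ gcl s t η b) :
    gcl s t η b = gcl s t η v := by
  ext w
  exact ⟨fun hw => gconn_trans s t (gconn_symm s t h) hw, fun hw => gconn_trans s t h hw⟩

theorem mem_gcl_self (η : E → Bool) (b : X) : b ∈ gcl s t η b := gconn_refl s t η b

variable [Fintype E] [DecidableEq E]

open Classical in
/-- Edges touching a set. -/
noncomputable def gtouch (C : Set X) : Finset E := Finset.univ.filter fun e => s e ∈ C ∨ t e ∈ C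

theorem mem_gtouch {C : Set X} {e : E} : e ∈ gtouch s t C ↔ s e ∈ C ∨ t e ∈ C := by
  simp [gtouch]

theorem gcl_explored (η η' : E → Bool) (b : X)
    (h : ∀ e ∈ gtouch s t (gcl s t η b), η e = η' e) : gcl s t η' b = gcl s t η b := by
  ext v
  constructor
  · intro hv
    change gconn s t η' b v at hv
    induction hv with
    | refl => exact mem_gcl_self s t η b
    | tail _ hstep ih =>
      obtain ⟨e, he, h1⟩ := hstep
      have hm : e ∈ gtouch s t (gcl s t η b) := by
        rw [mem_gtouch]
        rcases h1 with ⟨h1, h2⟩ | ⟨h1, h2⟩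
        · left; rw [h1]; exact ih
        · right; rw [h2]; exact ih
      exact Relation.ReflTransGen.tail ih ⟨e, (h e hm).trans he, h1⟩
  · intro hv
    change gconn s t η b v at hv
    induction hv with
    | refl => exact mem_gcl_self s t η' b
    | tail hpre hstep ih =>
      obtain ⟨e, he, h1⟩ := hstep
      have hm : e ∈ gtouch s t (gcl s t η b) := by
        rw [mem_gtouch]
        rcases h1 with ⟨h1, h2⟩ | ⟨h1, h2⟩
        · left; rw [h1]; exact hpre
        · right; rw [h2]; exact hpre
      exact Relation.ReflTransGen.tail ih ⟨e, (h e hm).symm.trans he, h1⟩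

/-- `e` touches a cluster of the set `B`. -/
def gT (B : Finset X) (η : E → Bool) (e : E) : Prop :=
  ∃ b ∈ B, gconn s t η b (s e) ∨ gconn s t η b (t e)

theorem gT_indep (B : Finset X) (η η' : E → Bool) (e : E) (h : ∀ f, f ≠ e → η f = η' f)
    (hT : gT s t B η e) : gT s t B η' e := by
  obtain ⟨b, hb, hc⟩ := hT
  refine ⟨b, hb, ?_⟩
  have key : ∀ v, gconn s t η b v →
      gconn s t η' b v ∨ (gconn s t η' b (s e) ∨ gconn s t η' b (t e)) := by
    intro v hv
    induction hv with
    | refl => left; exact gconn_refl s t η' b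
    | tail _ hstep ih =>
      rcases ih with ih | ih
      · obtain ⟨f, hf, h1⟩ := hstep
        by_cases hfe : f = e
        · subst hfe
          right
          rcases h1 with ⟨h1, h2⟩ | ⟨h1, h2⟩
          · left; rw [h1]; exact ih
          · right; rw [h2]; exact ih
        · left
          exact Relation.ReflTransGen.tail ih ⟨f, (h f hfe) ▸ hf, h1⟩
      · right; exact ih
  rcases hc with hc | hc
  · rcases key _ hc with h1 | h1
    · exact Or.inl h1
    · exact h1
  · rcases key _ hc with h1 | h1
    · exact Or.inr h1
    · exact h1

/-- Bernoulli weights. -/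
noncomputable def bw (p : ℝ) (b : Bool) : ℝ := if b then p else 1 - p

/-- Weight of a finite configuration. -/
noncomputable def gW (p : ℝ) (η : E → Bool) : ℝ := ∏ e, bw p (η e)

theorem bw_nonneg {p : ℝ} (h0 : 0 ≤ p) (h1 : p ≤ 1) (b : Bool) : 0 ≤ bw p b := by
  cases b <;> simp [bw, h0, h1]

theorem gW_nonneg {p : ℝ} (h0 : 0 ≤ p) (h1 : p ≤ 1) (η : E → Bool) : 0 ≤ gW p η :=
  Finset.prod_nonneg fun _ _ => bw_nonneg h0 h1 _

open Classical in
theorem sum_prod_bool (g : E → Bool → ℝ) :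
    ∑ η : E → Bool, ∏ e, g e (η e) = ∏ e, (g e true + g e false) := by
  have := (Finset.prod_univ_sum (fun _ : E => (Finset.univ : Finset Bool)) g)
  simp only [Fintype.piFinset_univ] at this
  rw [← this]
  simp

open Classical in
theorem sum_gW (p : ℝ) : ∑ η : E → Bool, gW p η = 1 := by
  unfold gW
  rw [sum_prod_bool (fun _ b => bw p b)]
  simp [bw]

open Classical in
/-- Stopping sets: changing the parameter inside the explored set keeps the total mass. -/
theorem explored_mass (T : (E → Bool) → Finset E)
    (hT : ∀ η η', (∀ e ∈ T η, η e = η' e) → T η' = T η) (p p' : ℝ) :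
    ∑ η : E → Bool, ∏ e, (if e ∈ T η then bw p' (η e) else bw p (η e)) = 1 := by
  have h1 : ∀ η : E → Bool, ∑ ζ : E → Bool,
      ∏ e, (if e ∈ T η then bw p (ζ e) else bw p' (ζ e)) = 1 := by
    intro η
    rw [sum_prod_bool (fun e b => if e ∈ T η then bw p b else bw p' b)]
    apply Finset.prod_eq_one
    intro e _
    split_ifs <;> simp [bw]
  let Φ : (E → Bool) × (E → Bool) → (E → Bool) × (E → Bool) := fun x =>
    (fun e => if e ∈ T x.1 then x.1 e else x.2 e, fun e => if e ∈ T x.1 then x.2 e else x.1 e)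
  have hTΦ : ∀ x, T (Φ x).1 = T x.1 := by
    intro x
    apply hT
    intro e he
    simp [Φ, he]
  have hΦ : ∀ x, Φ (Φ x) = x := by
    intro x
    apply Prod.ext
    · funext e
      change (if e ∈ T (Φ x).1 then (Φ x).1 e else (Φ x).2 e) = x.1 e
      rw [hTΦ]
      by_cases he : e ∈ T x.1 <;> simp [Φ, he]
    · funext e
      change (if e ∈ T (Φ x).1 then (Φ x).2 e else (Φ x).1 e) = x.2 e
      rw [hTΦ]
      by_cases he : e ∈ T x.1 <;> simp [Φ, he]
  calc ∑ η : E → Bool, ∏ e, (if e ∈ T η then bw p' (η e) else bw p (η e))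
      = ∑ η : E → Bool, ∑ ζ : E → Bool,
        (∏ e, (if e ∈ T η then bw p' (η e) else bw p (η e))) *
        ∏ e, (if e ∈ T η then bw p (ζ e) else bw p' (ζ e)) := by
          refine Finset.sum_congr rfl fun η _ => ?_
          rw [← Finset.mul_sum, h1, mul_one]
    _ = ∑ x : (E → Bool) × (E → Bool),
        (∏ e, (if e ∈ T x.1 then bw p' (x.1 e) else bw p (x.1 e))) *
        ∏ e, (if e ∈ T x.1 then bw p (x.2 e) else bw p' (x.2 e)) := by
          rw [Fintype.sum_prod_type]
    _ = ∑ x : (E → Bool) × (E → Bool), gW p' x.1 * gW p x.2 := by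
          refine Finset.sum_nbij' Φ Φ (fun _ _ => Finset.mem_univ _) (fun _ _ => Finset.mem_univ _)
            (fun x _ => hΦ x) (fun x _ => hΦ x) ?_
          intro x _
          unfold gW
          rw [← Finset.prod_mul_distrib, ← Finset.prod_mul_distrib]
          refine Finset.prod_congr rfl fun e _ => ?_
          by_cases he : e ∈ T x.1 <;> simp [Φ, he, mul_comm]
    _ = 1 := by
          rw [Fintype.sum_prod_type]
          simp_rw [← Finset.mul_sum, sum_gW, mul_one]
          exact sum_gW p'

open Classical in
theorem explored_exp (T : (E → Bool) → Finset E)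
    (hT : ∀ η η', (∀ e ∈ T η, η e = η' e) → T η' = T η) {p : ℝ} (h0 : 0 ≤ p) (h1 : p ≤ 1)
    (w : Bool → ℝ) (hw : ∀ b, 0 ≤ w b) (hw1 : p * w true + (1 - p) * w false ≤ 1) :
    ∑ η : E → Bool, gW p η * ∏ e ∈ T η, w (η e) ≤ 1 := by
  rw [← explored_mass T hT p (p * w true)]
  refine Finset.sum_le_sum fun η _ => ?_
  have h2 : ∏ e ∈ T η, w (η e) = ∏ e, (if e ∈ T η then w (η e) else 1) := by
    rw [Finset.prod_ite_mem, Finset.univ_inter]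
  rw [h2, gW, ← Finset.prod_mul_distrib]
  refine Finset.prod_le_prod (fun e _ => ?_) fun e _ => ?_
  · apply mul_nonneg (bw_nonneg h0 h1 _)
    split_ifs
    · exact hw _
    · exact zero_le_one
  · by_cases he : e ∈ T η
    · simp only [he, if_true]
      cases η e <;> simp [bw]
      linarith
    · simp [he]

open Classical in
theorem mean_zero (B : Finset X) (p : ℝ) (e : E) :
    ∑ η : E → Bool, gW p η *
      (if gT s t B η e then (p - if η e then (1:ℝ) else 0) else 0) = 0 := by
  refine Finset.sum_involution (fun η _ => Function.update η e (!η e)) ?_ ?_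
    (fun _ _ => Finset.mem_univ _) ?_
  · intro η _
    have hiff : gT s t B (Function.update η e (!η e)) e ↔ gT s t B η e := by
      constructor
      · apply gT_indep; intro f hf; simp [hf]
      · apply gT_indep; intro f hf; simp [hf]
    have hW : ∀ ζ : E → Bool, gW p ζ = bw p (ζ e) * ∏ f ∈ Finset.univ.erase e, bw p (ζ f) := by
      intro ζ
      rw [gW, Finset.mul_prod_erase Finset.univ (fun f => bw p (ζ f)) (Finset.mem_univ e)]
    have hr : ∏ f ∈ Finset.univ.erase e, bw p (Function.update η e (!η e) f)
        = ∏ f ∈ Finset.univ.erase e, bw p (η f) := by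
      refine Finset.prod_congr rfl fun f hf => ?_
      rw [Function.update_of_ne (Finset.ne_of_mem_erase hf)]
    rw [hW, hW (Function.update η e (!η e)), hr]
    simp only [hiff, Function.update_self]
    by_cases hg : gT s t B η e
    · simp only [hg, if_true]
      cases η e <;> simp [bw] <;> ring
    · simp [hg]
  · intro η _ _ heq
    have := congrFun heq e
    simp at this
  · intro η _
    simp

/-- The two-arm event at the edge `e`. -/
def gD (B : Finset X) (η : E → Bool) (e : E) : Prop :=
  η e = false ∧ ¬ gconn s t η (s e) (t e) ∧ (∃ b ∈ B, gconn s t η b (s e)) ∧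
    (∃ b ∈ B, gconn s t η b (t e))

open Classical in
/-- Number of clusters of `B` touched by `e`. -/
noncomputable def gN (B : Finset X) (η : E → Bool) (e : E) : ℕ :=
  ((B.image (gcl s t η)).filter fun C => s e ∈ C ∨ t e ∈ C).card

open Classical in
theorem gN_sub (B : Finset X) (η : E → Bool) (e : E) :
    ((B.image (gcl s t η)).filter fun C => s e ∈ C ∨ t e ∈ C) ⊆
      {gcl s t η (s e), gcl s t η (t e)} := by
  intro C hC
  rw [Finset.mem_filter, Finset.mem_image] at hC
  obtain ⟨⟨b, _, rfl⟩, hC⟩ := hC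
  rw [Finset.mem_insert, Finset.mem_singleton]
  rcases hC with h | h
  · left; exact gcl_eq_of_mem s t h
  · right; exact gcl_eq_of_mem s t h

theorem gN_le_two (B : Finset X) (η : E → Bool) (e : E) : gN s t B η e ≤ 2 := by
  classical
  exact (Finset.card_le_card (gN_sub s t B η e)).trans Finset.card_le_two

theorem gN_ineq (B : Finset X) (η : E → Bool) (e : E) {p : ℝ} (h0 : 0 ≤ p)
    [Decidable (gT s t B η e)] [Decidable (gD s t B η e)] :
    (if gT s t B η e then (p - if η e then (1:ℝ) else 0) else 0) +
      p * (if gD s t B η e then 1 else 0) ≤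
    (gN s t B η e : ℝ) * (p - if η e then (1:ℝ) else 0) := by
  classical
  by_cases hT : gT s t B η e
  · have hN1 : 1 ≤ gN s t B η e := by
      obtain ⟨b, hb, h⟩ := hT
      apply Finset.card_pos.mpr
      refine ⟨gcl s t η b, ?_⟩
      rw [Finset.mem_filter]
      exact ⟨Finset.mem_image_of_mem _ hb, h⟩
    cases hη : η e with
    | true =>
      have hD : ¬ gD s t B η e := by
        intro h; rw [h.1] at hη; exact Bool.noConfusion hη
      have hN2 : gN s t B η e ≤ 1 := by
        refine (Finset.card_le_card (gN_sub s t B η e)).trans ?_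
        rw [gcl_eq_of_mem s t (show t e ∈ gcl s t η (s e) from gconn_edge s t hη)]
        simp
      have : gN s t B η e = 1 := le_antisymm hN2 hN1
      simp [hT, hD, this]
    | false =>
      by_cases hD : gD s t B η e
      · have hN2 : 2 ≤ gN s t B η e := by
          obtain ⟨_, hne, ⟨b, hb, h1⟩, ⟨b', hb', h2⟩⟩ := hD
          have : ({gcl s t η (s e), gcl s t η (t e)} : Finset (Set X)).card = 2 := by
            apply Finset.card_pair
            intro h
            apply hne
            have : t e ∈ gcl s t η (s e) := by rw [h]; exact mem_gcl_self s t η _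
            exact this
          rw [← this]
          apply Finset.card_le_card
          intro C hC
          rw [Finset.mem_insert, Finset.mem_singleton] at hC
          rw [Finset.mem_filter, Finset.mem_image]
          rcases hC with rfl | rfl
          · exact ⟨⟨b, hb, gcl_eq_of_mem s t h1⟩, Or.inl (mem_gcl_self s t η _)⟩
          · exact ⟨⟨b', hb', gcl_eq_of_mem s t h2⟩, Or.inr (mem_gcl_self s t η _)⟩
        have : (2:ℝ) ≤ gN s t B η e := by exact_mod_cast hN2
        simp [hT, hD]
        nlinarith
      · have : (1:ℝ) ≤ gN s t B η e := by exact_mod_cast hN1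
        simp [hT, hD]
        nlinarith
  · have hD : ¬ gD s t B η e := by
      rintro ⟨_, _, ⟨b, hb, h1⟩, _⟩
      exact hT ⟨b, hb, Or.inl h1⟩
    have hN : gN s t B η e = 0 := by
      unfold gN
      rw [Finset.card_eq_zero, Finset.filter_eq_empty_iff]
      intro C hC h
      rw [Finset.mem_image] at hC
      obtain ⟨b, hb, rfl⟩ := hC
      exact hT ⟨b, hb, h⟩
    simp [hT, hD, hN]

open Classical in
theorem gN_sum (B : Finset X) (η : E → Bool) (g : E → ℝ) :
    ∑ C ∈ B.image (gcl s t η), ∑ e ∈ gtouch s t C, g e = ∑ e, (gN s t B η e : ℝ) * g e := by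
  have : ∀ C : Set X, ∑ e ∈ gtouch s t C, g e = ∑ e, if s e ∈ C ∨ t e ∈ C then g e else 0 := by
    intro C
    rw [gtouch, Finset.sum_filter]
  simp_rw [this]
  rw [Finset.sum_comm]
  refine Finset.sum_congr rfl fun e _ => ?_
  rw [← Finset.sum_filter, Finset.sum_const, nsmul_eq_mul]
  rfl

theorem exp_weight {p δ : ℝ} (h0 : 0 ≤ p) (h1 : p ≤ 1) (hδ : 0 < δ) (hδ1 : δ ≤ 1) :
    p * Real.exp (δ * (p - 1 - δ)) + (1 - p) * Real.exp (δ * (p - 0 - δ)) ≤ 1 := by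
  have e1 : Real.exp (δ * (p - 1)) ≤ 1 + δ * (p - 1) + (δ * (p - 1)) ^ 2 := by
    have := Real.abs_exp_sub_one_sub_id_le (x := δ * (p - 1)) (by rw [abs_le]; constructor <;> nlinarith)
    linarith [(abs_le.mp this).2]
  have e2 : Real.exp (δ * p) ≤ 1 + δ * p + (δ * p) ^ 2 := by
    have := Real.abs_exp_sub_one_sub_id_le (x := δ * p) (by rw [abs_le]; constructor <;> nlinarith)
    linarith [(abs_le.mp this).2]
  have e3 : p * Real.exp (δ * (p - 1)) + (1 - p) * Real.exp (δ * p) ≤ 1 + δ ^ 2 := by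
    have a1 := mul_le_mul_of_nonneg_left e1 h0
    have a2 := mul_le_mul_of_nonneg_left e2 (sub_nonneg.2 h1)
    have a3 : p * (1 - p) ≤ 1 := by nlinarith
    nlinarith [sq_nonneg δ]
  have e4 : 1 + δ ^ 2 ≤ Real.exp (δ ^ 2) := by linarith [Real.add_one_le_exp (δ ^ 2)]
  have e5 : Real.exp (δ * (p - 1 - δ)) = Real.exp (δ * (p - 1)) * Real.exp (-δ ^ 2) := by
    rw [← Real.exp_add]; ring_nf
  have e6 : Real.exp (δ * (p - 0 - δ)) = Real.exp (δ * p) * Real.exp (-δ ^ 2) := by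
    rw [← Real.exp_add]; ring_nf
  rw [e5, e6]
  calc _ = (p * Real.exp (δ * (p - 1)) + (1 - p) * Real.exp (δ * p)) * Real.exp (-δ ^ 2) := by ring
    _ ≤ Real.exp (δ ^ 2) * Real.exp (-δ ^ 2) :=
        mul_le_mul_of_nonneg_right (e3.trans e4) (Real.exp_pos _).le
    _ = 1 := by rw [← Real.exp_add]; simp

open Classical in
theorem pointwise (B : Finset X) (η : E → Bool) {p δ : ℝ} (h0 : 0 ≤ p) (hδ : 0 < δ) :
    (∑ e, if gT s t B η e then (p - if η e then (1:ℝ) else 0) else 0) +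
      p * (∑ e, if gD s t B η e then (1:ℝ) else 0) ≤
    2 * δ * Fintype.card E + (1 / δ) * ∑ b ∈ B, ∏ e ∈ gtouch s t (gcl s t η b),
      Real.exp (δ * (p - (if η e then (1:ℝ) else 0) - δ)) := by
  have a1 : (∑ e, if gT s t B η e then (p - if η e then (1:ℝ) else 0) else 0) +
      p * (∑ e, if gD s t B η e then (1:ℝ) else 0) ≤
      ∑ e, (gN s t B η e : ℝ) * (p - if η e then (1:ℝ) else 0) := by
    rw [Finset.mul_sum, ← Finset.sum_add_distrib]
    exact Finset.sum_le_sum fun e _ => gN_ineq s t B η e h0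
  refine a1.trans ?_
  rw [← gN_sum]
  have a2 : ∀ C : Set X, ∑ e ∈ gtouch s t C, (p - if η e then (1:ℝ) else 0) ≤
      (∑ e ∈ gtouch s t C, δ) + (1 / δ) * ∏ e ∈ gtouch s t C,
        Real.exp (δ * (p - (if η e then (1:ℝ) else 0) - δ)) := by
    intro C
    rw [← Real.exp_sum, ← Finset.mul_sum, ← sub_le_iff_le_add', ← Finset.sum_sub_distrib]
    set y := ∑ e ∈ gtouch s t C, (p - (if η e then (1:ℝ) else 0) - δ)
    have := Real.add_one_le_exp (δ * y)
    rw [one_div, inv_mul_eq_div, le_div_iff₀ hδ]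
    linarith
  refine (Finset.sum_le_sum fun C _ => a2 C).trans ?_
  rw [Finset.sum_add_distrib, gN_sum]
  apply add_le_add
  · calc ∑ e, (gN s t B η e : ℝ) * δ ≤ ∑ e : E, 2 * δ := by
          refine Finset.sum_le_sum fun e _ => ?_
          have : (gN s t B η e : ℝ) ≤ 2 := by exact_mod_cast gN_le_two s t B η e
          exact mul_le_mul_of_nonneg_right this hδ.le
      _ = 2 * δ * Fintype.card E := by
          rw [Finset.sum_const, nsmul_eq_mul, Finset.card_univ]; ring
  · rw [← Finset.mul_sum]
    apply mul_le_mul_of_nonneg_left _ (by positivity)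
    exact Finset.sum_image_le_of_nonneg (f := fun C => ∏ e ∈ gtouch s t C,
        Real.exp (δ * (p - (if η e then (1:ℝ) else 0) - δ)))
      (fun C _ => Finset.prod_nonneg fun e _ => (Real.exp_pos _).le)

open Classical in
/-- The finite-volume two-arm estimate. -/
theorem two_arm (B : Finset X) {p δ : ℝ} (h0 : 0 ≤ p) (h1 : p ≤ 1) (hδ : 0 < δ) (hδ1 : δ ≤ 1) :
    p * (∑ e : E, ∑ η : E → Bool, gW p η * (if gD s t B η e then (1:ℝ) else 0)) ≤
      2 * δ * Fintype.card E + (1 / δ) * B.card := by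
  have hsum := Finset.sum_le_sum (s := (Finset.univ : Finset (E → Bool))) fun η _ =>
    mul_le_mul_of_nonneg_left (pointwise s t B η h0 hδ) (gW_nonneg h0 h1 η)
  have hL : ∑ η : E → Bool, gW p η *
      ((∑ e, if gT s t B η e then (p - if η e then (1:ℝ) else 0) else 0) +
      p * (∑ e, if gD s t B η e then (1:ℝ) else 0)) =
      p * (∑ e : E, ∑ η : E → Bool, gW p η * (if gD s t B η e then (1:ℝ) else 0)) := by
    simp_rw [mul_add, Finset.sum_add_distrib, Finset.mul_sum]
    rw [Finset.sum_comm, Finset.sum_eq_zero (fun e _ => mean_zero s t B p e), zero_add,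
      Finset.sum_comm]
    refine Finset.sum_congr rfl fun e _ => Finset.sum_congr rfl fun η _ => ?_
    ring
  have hR : ∑ η : E → Bool, gW p η *
      (2 * δ * Fintype.card E + (1 / δ) * ∑ b ∈ B, ∏ e ∈ gtouch s t (gcl s t η b),
      Real.exp (δ * (p - (if η e then (1:ℝ) else 0) - δ))) ≤
      2 * δ * Fintype.card E + (1 / δ) * B.card := by
    simp_rw [mul_add, Finset.sum_add_distrib]
    rw [← Finset.sum_mul, sum_gW, one_mul]
    apply add_le_add le_rfl
    calc ∑ η : E → Bool, gW p η * ((1 / δ) * ∑ b ∈ B, ∏ e ∈ gtouch s t (gcl s t η b),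
          Real.exp (δ * (p - (if η e then (1:ℝ) else 0) - δ)))
        = (1 / δ) * ∑ b ∈ B, ∑ η : E → Bool, gW p η * ∏ e ∈ gtouch s t (gcl s t η b),
          Real.exp (δ * (p - (if η e then (1:ℝ) else 0) - δ)) := by
            rw [Finset.sum_comm, Finset.mul_sum]
            refine Finset.sum_congr rfl fun η _ => ?_
            rw [← Finset.mul_sum]
            ring
      _ ≤ (1 / δ) * ∑ b ∈ B, 1 := by
            apply mul_le_mul_of_nonneg_left _ (by positivity)
            refine Finset.sum_le_sum fun b _ => ?_
            refine explored_exp (fun η => gtouch s t (gcl s t η b)) ?_ h0 h1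
              (fun b => Real.exp (δ * (p - (if b then (1:ℝ) else 0) - δ)))
              (fun _ => (Real.exp_pos _).le) ?_
            · intro η η' h
              change gtouch s t (gcl s t η' b) = gtouch s t (gcl s t η b)
              rw [gcl_explored s t η η' b h]
            · simpa using exp_weight h0 h1 hδ hδ1
      _ = (1 / δ) * B.card := by simp
  rw [hL] at hsum
  exact hsum.trans hR

end Finite
/-! ### Lattice connectivity -/

section Lattice

variable {d : ℕ}

/-- Connection by open edges. -/
def lconn (ω : Config d) : V d → V d → Prop := Relation.ReflTransGen (edgeOpen ω)

theorem edgeOpen_symm {ω : Config d} {x y : V d} (h : edgeOpen ω x y) : edgeOpen ω y x := by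
  unfold edgeOpen at *
  rwa [Sym2.eq_swap]

theorem lconn_refl (ω : Config d) (x : V d) : lconn ω x x := Relation.ReflTransGen.refl

theorem lconn_trans {ω : Config d} {x y z : V d} (h : lconn ω x y) (h' : lconn ω y z) :
    lconn ω x z := Relation.ReflTransGen.trans h h'

theorem lconn_symm {ω : Config d} {x y : V d} (h : lconn ω x y) : lconn ω y x := by
  induction h with
  | refl => exact lconn_refl ω _
  | tail _ hstep ih => exact Relation.ReflTransGen.head (edgeOpen_symm hstep) ih

theorem path_lconn {ω : Config d} {n : ℕ} {f : ℕ → V d} (h : IsOpenPath ω n f) :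
    lconn ω (f 0) (f n) := by
  induction n with
  | zero => exact lconn_refl ω _
  | succ n ih =>
    exact Relation.ReflTransGen.tail (ih fun i hi => h i (hi.trans (Nat.lt_succ_self n)))
      (h n (Nat.lt_succ_self n))

theorem lconn_path {ω : Config d} {x y : V d} (h : lconn ω x y) :
    ∃ (n : ℕ) (f : ℕ → V d), IsOpenPath ω n f ∧ f 0 = x ∧ f n = y := by
  induction h with
  | refl => exact ⟨0, fun _ => x, fun i hi => absurd hi (Nat.not_lt_zero i), rfl, rfl⟩
  | @tail b c _ hstep ih =>
    obtain ⟨n, f, hf, h0, hn⟩ := ih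
    refine ⟨n + 1, fun i => if i ≤ n then f i else c, ?_, by simp [h0], by simp⟩
    intro i hi
    rcases Nat.lt_succ_iff_lt_or_eq.mp hi with hi | rfl
    · have h2 : i + 1 ≤ n := hi
      simp only [hi.le, h2, if_true]
      exact hf i hi
    · simp only [le_refl, if_true, Nat.not_succ_le_self, if_false]
      rw [hn]
      exact hstep

theorem connected_iff {ω : Config d} {x y : V d} : Connected ω x y ↔ lconn ω x y := by
  constructor
  · intro h
    by_contra hc
    apply h
    unfold chemDist
    rw [sInf_eq_top]
    rintro r ⟨n, f, hf, h0, hn, _⟩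
    exact absurd (h0 ▸ hn ▸ path_lconn hf) hc
  · intro h
    obtain ⟨n, f, hf, h0, hn⟩ := lconn_path h
    have : chemDist ω x y ≤ n := sInf_le ⟨n, f, hf, h0, hn, rfl⟩
    exact ne_top_of_le_ne_top (ENNReal.natCast_ne_top n) this

theorem inf_iff {ω : Config d} {x : V d} :
    InInfiniteCluster ω x ↔ {y | lconn ω x y}.Infinite := by
  unfold InInfiniteCluster cluster
  simp only [connected_iff]

theorem inf_congr {ω : Config d} {x y : V d} (h : lconn ω x y) (hx : InInfiniteCluster ω x) :
    InInfiniteCluster ω y := by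
  rw [inf_iff] at *
  refine hx.mono fun z hz => ?_
  exact lconn_trans (lconn_symm h) hz

theorem openE_mono {ω ω' : Config d} (h : ∀ e, ω e = true → ω' e = true) {x y : V d}
    (ho : edgeOpen ω x y) : edgeOpen ω' x y := by
  obtain ⟨h1, h2⟩ := ho
  exact ⟨h1, h _ h2⟩

theorem lconn_mono {ω ω' : Config d} (h : ∀ e, ω e = true → ω' e = true) {x y : V d}
    (hc : lconn ω x y) : lconn ω' x y :=
  Relation.ReflTransGen.mono (fun _ _ => openE_mono h) _ _ hc

theorem inf_mono {ω ω' : Config d} (h : ∀ e, ω e = true → ω' e = true) {x : V d}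
    (hc : InInfiniteCluster ω x) : InInfiniteCluster ω' x := by
  rw [inf_iff] at *
  exact hc.mono fun y hy => lconn_mono h hy

theorem chemDist_mono {ω ω' : Config d} (h : ∀ e, ω e = true → ω' e = true) (x y : V d) :
    chemDist ω' x y ≤ chemDist ω x y := by
  unfold chemDist
  apply sInf_le_sInf
  rintro r ⟨n, f, hf, h'⟩
  exact ⟨n, f, fun i hi => openE_mono h (hf i hi), h'⟩

theorem dist1_eq_zero {x y : V d} (h : dist1 x y = 0) : x = y := by
  funext i
  unfold dist1 at h
  rw [Finset.sum_eq_zero_iff] at h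
  have := h i (Finset.mem_univ i)
  omega

theorem dist1_self (x : V d) : dist1 x x = 0 := by simp [dist1]

theorem regPoint_of_inf {ω : Config d} {x : V d} (h : InInfiniteCluster ω x) :
    regPoint ω x = x := by
  have hex : ∃ y : V d, InInfiniteCluster ω y ∧
      ∀ z : V d, InInfiniteCluster ω z → dist1 x y ≤ dist1 x z :=
    ⟨x, h, fun z _ => by rw [dist1_self]; exact Nat.zero_le _⟩
  unfold regPoint
  rw [dif_pos hex]
  have h2 := hex.choose_spec.2 x h
  rw [dist1_self] at h2
  exact (dist1_eq_zero (Nat.le_zero.mp h2)).symm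

theorem dist1_eq_one {x y : V d} (h : dist1 x y = 1) :
    ∃ k, y = x + Pi.single k 1 ∨ x = y + Pi.single k 1 := by
  classical
  unfold dist1 at h
  have h1 : ∃ k, (x k - y k).natAbs ≠ 0 := by
    by_contra hc
    push Not at hc
    rw [Finset.sum_eq_zero fun i _ => hc i] at h
    exact absurd h (by norm_num)
  obtain ⟨k, hk⟩ := h1
  rw [← Finset.add_sum_erase _ _ (Finset.mem_univ k)] at h
  have h2 : ∑ i ∈ Finset.univ.erase k, (x i - y i).natAbs = 0 := by omega
  rw [Finset.sum_eq_zero_iff] at h2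
  have h3 : ∀ i, i ≠ k → x i = y i := by
    intro i hi
    have := h2 i (Finset.mem_erase.mpr ⟨hi, Finset.mem_univ i⟩)
    omega
  have h4 : (x k - y k).natAbs = 1 := by omega
  refine ⟨k, ?_⟩
  rcases Int.natAbs_eq (x k - y k) with h5 | h5
  · right
    funext i
    by_cases hi : i = k
    · subst hi; simp; omega
    · simp [hi, h3 i hi]
  · left
    funext i
    by_cases hi : i = k
    · subst hi; simp; omega
    · simp [hi, h3 i hi]

theorem dist1_step (x : V d) (k : Fin d) : dist1 x (x + Pi.single k 1) = 1 := by
  classical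
  unfold dist1
  rw [Finset.sum_eq_single k]
  · simp
  · intro i _ hi; simp [hi]
  · simp

/-- The edge `(x, x + e_k)`. -/
def mkE (x : V d) (k : Fin d) : Edge d := ⟨s(x, x + Pi.single k 1), dist1_step x k⟩

theorem edgeOpen_mkE {ω : Config d} {x : V d} {k : Fin d} :
    edgeOpen ω x (x + Pi.single k 1) ↔ ω (mkE x k) = true :=
  ⟨fun ⟨_, h⟩ => h, fun h => ⟨dist1_step x k, h⟩⟩

theorem mkE_inj {x y : V d} {k j : Fin d} (h : mkE x k = mkE y j) : x = y ∧ k = j := by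
  have h1 : s(x, x + Pi.single k 1) = s(y, y + Pi.single j 1) := congrArg Subtype.val h
  rw [Sym2.eq_iff] at h1
  rcases h1 with ⟨rfl, h2⟩ | ⟨h1, h2⟩
  · refine ⟨rfl, ?_⟩
    have h3 := congrFun (add_left_cancel h2) k
    by_contra hne
    simp [hne] at h3
  · exfalso
    have a := congrFun h1 k
    have b := congrFun h2 k
    simp only [Pi.add_apply, Pi.single_eq_same] at a b
    have c : (0:ℤ) ≤ (Pi.single j 1 : V d) k := by
      have : (0 : V d) ≤ Pi.single j 1 := Pi.single_nonneg.mpr zero_le_one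
      exact this k
    omega

instance : Countable (Edge d) := by
  unfold Edge
  have : Countable (Sym2 (V d)) := by
    unfold Sym2
    infer_instance
  infer_instance

theorem meas_edgeOpen (x y : V d) : MeasurableSet {ω : Config d | edgeOpen ω x y} := by
  unfold edgeOpen openE
  by_cases h : sym2dist1 s(x, y) = 1
  · have : {ω : Config d | ∃ h : sym2dist1 s(x, y) = 1, ω ⟨s(x, y), h⟩ = true} =
        (fun ω : Config d => ω ⟨s(x, y), h⟩) ⁻¹' {true} := by
      ext ω; simp [h]
    rw [this]
    exact (measurable_pi_apply _) (measurableSet_singleton _)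
  · have : {ω : Config d | ∃ h : sym2dist1 s(x, y) = 1, ω ⟨s(x, y), h⟩ = true} = ∅ := by
      ext ω; simp [h]
    rw [this]
    exact MeasurableSet.empty

/-- Connection in exactly `n` steps. -/
def reach (ω : Config d) : ℕ → V d → V d → Prop
  | 0, x, y => x = y
  | n + 1, x, y => ∃ z, reach ω n x z ∧ edgeOpen ω z y

theorem reach_iff {ω : Config d} {x y : V d} : lconn ω x y ↔ ∃ n, reach ω n x y := by
  constructor
  · intro h
    induction h with
    | refl => exact ⟨0, rfl⟩
    | tail _ hstep ih =>
      obtain ⟨n, hn⟩ := ih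
      exact ⟨n + 1, _, hn, hstep⟩
  · rintro ⟨n, hn⟩
    induction n generalizing y with
    | zero => exact hn ▸ lconn_refl ω x
    | succ n ih =>
      obtain ⟨z, hz, hs⟩ := hn
      exact Relation.ReflTransGen.tail (ih hz) hs

theorem meas_reach (n : ℕ) (x y : V d) : MeasurableSet {ω : Config d | reach ω n x y} := by
  induction n generalizing y with
  | zero => exact MeasurableSet.const _
  | succ n ih =>
    have : {ω : Config d | reach ω (n + 1) x y} =
        ⋃ z, ({ω : Config d | reach ω n x z} ∩ {ω | edgeOpen ω z y}) := by
      ext ω; simp [reach]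
    rw [this]
    exact MeasurableSet.iUnion fun z => (ih z).inter (meas_edgeOpen z y)

theorem meas_lconn (x y : V d) : MeasurableSet {ω : Config d | lconn ω x y} := by
  have : {ω : Config d | lconn ω x y} = ⋃ n, {ω : Config d | reach ω n x y} := by
    ext ω; simp [reach_iff]
  rw [this]
  exact MeasurableSet.iUnion fun n => meas_reach n x y

theorem meas_inf (x : V d) : MeasurableSet {ω : Config d | InInfiniteCluster ω x} := by
  have : {ω : Config d | InInfiniteCluster ω x} =
      ⋂ t : Finset (V d), ⋃ y : {y : V d // y ∉ t}, {ω : Config d | lconn ω x y} := by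
    ext ω
    simp only [Set.mem_ofPred_eq, Set.mem_iInter, Set.mem_iUnion, inf_iff]
    constructor
    · intro h t
      obtain ⟨y, hy, hyt⟩ := h.exists_notMem_finset t
      exact ⟨⟨y, hyt⟩, hy⟩
    · intro h hfin
      obtain ⟨⟨y, hyt⟩, hy⟩ := h hfin.toFinset
      exact hyt (hfin.mem_toFinset.mpr hy)
  rw [this]
  exact MeasurableSet.iInter fun t => MeasurableSet.iUnion fun y => meas_lconn x y

/-- `x` and `y` lie in distinct infinite clusters. -/
def Dis (x y : V d) : Set (Config d) :=
  {ω | InInfiniteCluster ω x ∧ InInfiniteCluster ω y ∧ ¬ lconn ω x y}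

theorem meas_Dis (x y : V d) : MeasurableSet (Dis x y) :=
  (meas_inf x).inter ((meas_inf y).inter (meas_lconn x y).compl)

/-! ### Translations -/

/-- Translation of pairs. -/
theorem sym2dist1_shift (x : V d) (e : Sym2 (V d)) :
    sym2dist1 (Sym2.map (fun y => y + x) e) = sym2dist1 e := by
  induction e using Sym2.ind with
  | _ a b => simp [sym2dist1, dist1]

/-- Translation of edges. -/
def shE (x : V d) (e : Edge d) : Edge d :=
  ⟨Sym2.map (fun y => y + x) e.1, (sym2dist1_shift x e.1).trans e.2⟩

/-- Translation of edges as an equivalence. -/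
def shEquiv (x : V d) : Edge d ≃ Edge d where
  toFun := shE x
  invFun := shE (-x)
  left_inv e := by
    apply Subtype.ext
    simp [shE, Sym2.map_map]
  right_inv e := by
    apply Subtype.ext
    simp [shE, Sym2.map_map]

/-- Translation of configurations. -/
def sh (x : V d) (ω : Config d) : Config d := fun e => ω (shE x e)

theorem edgeOpen_sh (x : V d) (ω : Config d) (u v : V d) :
    edgeOpen (sh x ω) u v ↔ edgeOpen ω (u + x) (v + x) := by
  constructor
  · rintro ⟨h, h2⟩
    exact ⟨(sym2dist1_shift x s(u, v)).trans h, h2⟩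
  · rintro ⟨h, h2⟩
    exact ⟨(sym2dist1_shift x s(u, v)).symm.trans h, h2⟩

theorem lconn_sh (x : V d) (ω : Config d) (u v : V d) :
    lconn (sh x ω) u v ↔ lconn ω (u + x) (v + x) := by
  constructor
  · intro h
    exact Relation.ReflTransGen.lift (fun y => y + x) (fun a b => (edgeOpen_sh x ω a b).mp) _ _ h
  · intro h
    have : lconn (sh x ω) (u + x - x) (v + x - x) := Relation.ReflTransGen.lift (p := edgeOpen (sh x ω)) (fun y => y - x)
      (fun a b hab => (edgeOpen_sh x ω (a - x) (b - x)).mpr (by simpa using hab)) _ _ h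
    simpa using this

theorem inf_sh (x : V d) (ω : Config d) (u : V d) :
    InInfiniteCluster (sh x ω) u ↔ InInfiniteCluster ω (u + x) := by
  rw [inf_iff, inf_iff]
  have : {y | lconn ω (u + x) y} = (fun y => y + x) '' {y | lconn (sh x ω) u y} := by
    ext y
    simp only [Set.mem_ofPred_eq, Set.mem_image, lconn_sh]
    constructor
    · intro h
      exact ⟨y - x, by simpa using h, by simp⟩
    · rintro ⟨z, hz, rfl⟩
      exact hz
  rw [this, Set.infinite_image_iff (add_left_injective x).injOn]

theorem inf_sh_iter (x : V d) (n : ℕ) (ω : Config d) (u : V d) :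
    InInfiniteCluster ((sh x)^[n] ω) u ↔ InInfiniteCluster ω (u + n • x) := by
  induction n generalizing ω with
  | zero => simp
  | succ n ih =>
    rw [Function.iterate_succ_apply, ih, inf_sh, add_assoc, succ_nsmul]

theorem Dis_sh (x u v : V d) : sh x ⁻¹' Dis u v = Dis (u + x) (v + x) := by
  ext ω
  simp only [Dis, Set.mem_preimage, Set.mem_ofPred_eq, inf_sh, lconn_sh]

theorem meas_sh (x : V d) : Measurable (sh x : Config d → Config d) :=
  measurable_pi_lambda _ fun _ => measurable_pi_apply _

end Lattice

/-! ### The product measures -/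

section Meas

variable {d : ℕ}

/-- Bernoulli law, as an image of the uniform law. -/
noncomputable def bern (p : ℝ) : Measure Bool :=
  (volume : Measure unitInterval).map (fun u : unitInterval => decide ((u : ℝ) ≤ p))

theorem meas_dec (p : ℝ) : Measurable (fun u : unitInterval => decide ((u : ℝ) ≤ p)) := by
  apply measurable_to_bool
  have : (fun u : unitInterval => decide ((u : ℝ) ≤ p)) ⁻¹' {true} = {u : unitInterval | (u : ℝ) ≤ p} := by
    ext u; simp
  rw [this]
  exact measurableSet_le measurable_subtype_coe measurable_const

instance (p : ℝ) : IsProbabilityMeasure (bern p) :=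
  Measure.isProbabilityMeasure_map (meas_dec p).aemeasurable

theorem bern_true {p : ℝ} (h0 : 0 ≤ p) (h1 : p ≤ 1) : bern p {true} = ENNReal.ofReal p := by
  unfold bern
  rw [Measure.map_apply (meas_dec p) (measurableSet_singleton _)]
  have : (fun u : unitInterval => decide ((u : ℝ) ≤ p)) ⁻¹' {true} = Set.Iic ⟨p, h0, h1⟩ := by
    ext u
    simp only [Set.mem_preimage, Set.mem_singleton_iff, decide_eq_true_eq, Set.mem_Iic]
    rfl
  rw [this, unitInterval.volume_Iic]

theorem bern_apply {p : ℝ} (h0 : 0 ≤ p) (h1 : p ≤ 1) (b : Bool) :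
    bern p {b} = ENNReal.ofReal (if b then p else 1 - p) := by
  cases b with
  | true => simpa using bern_true h0 h1
  | false =>
    have : ({false} : Set Bool) = {true}ᶜ := by ext b; cases b <;> simp
    rw [this, prob_compl_eq_one_sub (measurableSet_singleton _), bern_true h0 h1]
    simp [ENNReal.ofReal_sub _ h0]

/-- The product measure. -/
noncomputable def perc (d : ℕ) (p : ℝ) : Measure (Config d) :=
  Measure.infinitePi fun _ : Edge d => bern p

instance (p : ℝ) : IsProbabilityMeasure (perc d p) := by unfold perc; infer_instance

theorem F_eq (F : BernoulliFamily d) {p : ℝ} (h0 : 0 ≤ p) (h1 : p ≤ 1) : F.P p = perc d p := by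
  classical
  have := F.prob p
  refine (Measure.isProjectiveLimit_infinitePi (fun _ : Edge d => bern p)).unique ?_ |>.symm
  intro s
  refine Measure.ext_of_singleton fun η => ?_
  rw [Measure.map_apply (by fun_prop) (measurableSet_singleton _), Measure.pi_singleton]
  let f : Edge d → Bool := fun e => if h : e ∈ s then η ⟨e, h⟩ else true
  have hset : (s.restrict : Config d → (s → Bool)) ⁻¹' {η} = {ω : Config d | ∀ e ∈ s, ω e = f e} := by
    ext ω
    simp only [Set.mem_preimage, Set.mem_singleton_iff, Set.mem_ofPred_eq]
    constructor
    · intro h e he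
      simp only [f, he, dif_pos, ← h]
      rfl
    · intro h
      funext ⟨e, he⟩
      have := h e he
      simpa [f, he] using this
  rw [hset, F.iid p h0 h1 s f, ← Finset.prod_attach, Finset.univ_eq_attach]
  refine Finset.prod_congr rfl fun e _ => ?_
  rw [bern_apply h0 h1]
  simp [f]

theorem perc_cyl {E : Type*} [Fintype E] (ι : E → Edge d) (hι : Function.Injective ι)
    {p : ℝ} (h0 : 0 ≤ p) (h1 : p ≤ 1) (η : E → Bool) :
    perc d p {ω | ∀ e, ω (ι e) = η e} = ENNReal.ofReal (gW p η) := by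
  classical
  have hset : {ω : Config d | ∀ e, ω (ι e) = η e} =
      Set.pi (Finset.univ.map ⟨ι, hι⟩ : Finset (Edge d))
        (fun e => {Function.extend ι η (fun _ => true) e}) := by
    ext ω
    simp [Set.mem_pi, hι.extend_apply]
  rw [hset, perc, Measure.infinitePi_pi _ (fun _ _ => measurableSet_singleton _), Finset.prod_map,
    gW, ENNReal.ofReal_prod_of_nonneg (fun e _ => bw_nonneg h0 h1 _)]
  refine Finset.prod_congr rfl fun e _ => ?_
  simp only [Function.Embedding.coeFn_mk, hι.extend_apply]
  exact bern_apply h0 h1 _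

theorem perc_sh (p : ℝ) (x : V d) : MeasurePreserving (sh x) (perc d p) (perc d p) := by
  classical
  refine ⟨meas_sh x, ?_⟩
  refine Measure.eq_infinitePi _ fun s t ht => ?_
  rw [Measure.map_apply (meas_sh x) (.pi s.countable_toSet fun _ _ => ht _)]
  have hset : sh x ⁻¹' (Set.pi s t) = Set.pi (s.map (shEquiv x).toEmbedding : Finset (Edge d))
      (fun e => t ((shEquiv x).symm e)) := by
    ext ω
    simp only [Set.mem_preimage, Set.mem_pi, Finset.mem_coe, Finset.mem_map]
    constructor
    · rintro h _ ⟨e, he, rfl⟩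
      rw [Equiv.coe_toEmbedding, Equiv.symm_apply_apply]
      exact h e he
    · intro h e he
      have := h (shEquiv x e) ⟨e, he, rfl⟩
      rw [Equiv.symm_apply_apply] at this
      exact this
  rw [hset, perc, Measure.infinitePi_pi _ (fun _ _ => ht _), Finset.prod_map]
  simp

open Classical in
theorem perc_update (p : ℝ) (e : Edge d) :
    ((perc d p).prod (bern p)).map (fun z => Function.update z.1 e z.2) = perc d p := by
  have hm : Measurable (fun z : Config d × Bool => Function.update z.1 e z.2) := by
    refine measurable_pi_lambda _ fun f => ?_
    by_cases h : f = e
    · subst h; simpa using measurable_snd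
    · simp only [Function.update_of_ne h]
      exact (measurable_pi_apply f).comp measurable_fst
  refine Measure.eq_infinitePi _ fun s t ht => ?_
  rw [Measure.map_apply hm (.pi s.countable_toSet fun _ _ => ht _)]
  have hset : (fun z : Config d × Bool => Function.update z.1 e z.2) ⁻¹' (Set.pi s t) =
      (Set.pi (s.erase e : Finset (Edge d)) t) ×ˢ (if e ∈ s then t e else Set.univ) := by
    ext ⟨ω, b⟩
    simp only [Set.mem_preimage, Set.mem_pi, Finset.mem_coe, Set.mem_prod, Finset.mem_erase]
    constructor
    · intro h
      refine ⟨fun f hf => by simpa [hf.1] using h f hf.2, ?_⟩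
      split_ifs with he
      · simpa using h e he
      · trivial
    · rintro ⟨h1, h2⟩ f hf
      by_cases hfe : f = e
      · subst hfe
        simpa [hf] using h2
      · simpa [hfe] using h1 f ⟨hfe, hf⟩
  rw [hset, Measure.prod_prod, perc, Measure.infinitePi_pi _ (fun _ _ => ht _)]
  by_cases he : e ∈ s
  · rw [if_pos he, Finset.prod_erase_mul _ _ he]
  · rw [if_neg he, measure_univ, mul_one, Finset.erase_eq_of_notMem he]

open Classical in
theorem insertion {p : ℝ} (h0 : 0 < p) (h1 : p ≤ 1) (e : Edge d) (M : Set (Config d))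
    (hM : MeasurableSet M) (hM0 : perc d p M = 0) :
    perc d p {ω | Function.update ω e true ∈ M} = 0 := by
  have hm : Measurable (fun z : Config d × Bool => Function.update z.1 e z.2) := by
    refine measurable_pi_lambda _ fun f => ?_
    by_cases h : f = e
    · subst h; simpa using measurable_snd
    · simp only [Function.update_of_ne h]
      exact (measurable_pi_apply f).comp measurable_fst
  rw [← perc_update p e, Measure.map_apply hm hM] at hM0
  have hsub : {ω : Config d | Function.update ω e true ∈ M} ×ˢ ({true} : Set Bool) ⊆
      (fun z : Config d × Bool => Function.update z.1 e z.2) ⁻¹' M := by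
    rintro ⟨ω, b⟩ ⟨h1, h2⟩
    simp only [Set.mem_singleton_iff] at h2
    subst h2
    exact h1
  have h2 := measure_mono_null hsub hM0
  rw [Measure.prod_prod, mul_eq_zero] at h2
  rcases h2 with h2 | h2
  · exact h2
  · rw [bern_true h0.le h1] at h2
    simp at h2
    linarith

end Meas
/-! ### Uniqueness of the infinite cluster -/

section Uniq

variable {d : ℕ}

/-- Index of the edges of the box. -/
abbrev BoxE (d n : ℕ) := (Finset.Icc (0 : V d) (fun _ => (n : ℤ))) × Fin d

/-- First endpoint. -/
def bs (n : ℕ) (e : BoxE d n) : V d := e.1.1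

/-- Second endpoint. -/
def bt (n : ℕ) (e : BoxE d n) : V d := e.1.1 + Pi.single e.2 1

/-- The edge. -/
def bι (n : ℕ) (e : BoxE d n) : Edge d := mkE e.1.1 e.2

theorem bι_inj (n : ℕ) : Function.Injective (bι (d := d) n) := by
  rintro ⟨⟨x, hx⟩, k⟩ ⟨⟨y, hy⟩, j⟩ h
  obtain ⟨h1, h2⟩ := mkE_inj h
  simp only at h1 h2
  subst h1 h2
  rfl

/-- The boundary of the box. -/
noncomputable def bdry (d n : ℕ) : Finset (V d) :=
  Finset.Icc (0 : V d) (fun _ => (n : ℤ) + 1) \ Finset.Icc (1 : V d) (fun _ => (n : ℤ))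

theorem card_bdry (n : ℕ) : ((bdry d n).card : ℝ) = ((n : ℝ) + 2) ^ d - (n : ℝ) ^ d := by
  have hsub : Finset.Icc (1 : V d) (fun _ => (n : ℤ)) ⊆
      Finset.Icc (0 : V d) (fun _ => (n : ℤ) + 1) := by
    apply Finset.Icc_subset_Icc
    · intro i; simp
    · intro i; simp
  have h1 : (Finset.Icc (1 : V d) (fun _ => (n : ℤ))).card = n ^ d := by
    rw [Pi.card_Icc]
    simp
  have h2 : (Finset.Icc (0 : V d) (fun _ => (n : ℤ) + 1)).card = (n + 2) ^ d := by
    rw [Pi.card_Icc]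
    simp
    congr 1
  unfold bdry
  rw [Finset.card_sdiff_of_subset hsub, h1, h2, Nat.cast_sub (Nat.pow_le_pow_left (by omega) d)]
  push_cast
  ring

theorem gconn_lconn (n : ℕ) (ω : Config d) {u v : V d}
    (h : gconn (bs n) (bt n) (fun e => ω (bι n e)) u v) : lconn ω u v := by
  induction h with
  | refl => exact lconn_refl ω _
  | tail _ hstep ih =>
    obtain ⟨e, he, h⟩ := hstep
    have ho : edgeOpen ω (bs n e) (bt n e) := edgeOpen_mkE.mpr he
    rcases h with ⟨rfl, rfl⟩ | ⟨rfl, rfl⟩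
    · exact Relation.ReflTransGen.tail ih ho
    · exact Relation.ReflTransGen.tail ih (edgeOpen_symm ho)

theorem inf_bdry (n : ℕ) (ω : Config d) {u : V d}
    (hu : u ∈ Finset.Icc (0 : V d) (fun _ => (n : ℤ) + 1)) (h : InInfiniteCluster ω u) :
    ∃ b ∈ bdry d n, gconn (bs n) (bt n) (fun e => ω (bι n e)) b u := by
  by_contra hc
  push Not at hc
  rw [inf_iff] at h
  apply h
  have key : ∀ v, lconn ω u v → gconn (bs n) (bt n) (fun e => ω (bι n e)) u v ∧
      v ∈ Finset.Icc (0 : V d) (fun _ => (n : ℤ) + 1) := by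
    intro v hv
    induction hv with
    | refl => exact ⟨gconn_refl _ _ _ _, hu⟩
    | @tail v w _ hstep ih =>
      obtain ⟨ih1, ih2⟩ := ih
      have hin : v ∈ Finset.Icc (1 : V d) (fun _ => (n : ℤ)) := by
        by_contra hnot
        exact hc v (Finset.mem_sdiff.mpr ⟨ih2, hnot⟩) (gconn_symm _ _ ih1)
      rw [Finset.mem_Icc, Pi.le_def, Pi.le_def] at hin
      obtain ⟨hlo, hhi⟩ := hin
      simp only [Pi.one_apply] at hlo
      obtain ⟨hd1, _⟩ := id hstep
      have hd2 : dist1 v w = 1 := hd1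
      obtain ⟨k, hk | hk⟩ := dist1_eq_one hd2
      · have hsg : ∀ i, (0:ℤ) ≤ (Pi.single k 1 : V d) i ∧ (Pi.single k 1 : V d) i ≤ 1 := by
          intro i; by_cases hi : i = k
          · subst hi; simp
          · simp [hi]
        have hvm : v ∈ Finset.Icc (0 : V d) (fun _ => (n : ℤ)) := by
          rw [Finset.mem_Icc, Pi.le_def, Pi.le_def]
          exact ⟨fun i => by have := hlo i; simp only [Pi.zero_apply]; omega, hhi⟩
        rw [hk] at hstep
        refine ⟨Relation.ReflTransGen.tail ih1
          ⟨(⟨v, hvm⟩, k), edgeOpen_mkE.mp hstep, Or.inl ⟨rfl, hk.symm⟩⟩, ?_⟩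
        rw [Finset.mem_Icc, Pi.le_def, Pi.le_def, hk]
        constructor
        · intro i; have := hlo i; have := hsg i; simp only [Pi.zero_apply, Pi.add_apply]; omega
        · intro i; have := hhi i; have := hsg i; simp only [Pi.add_apply]; omega
      · have hsg : ∀ i, (0:ℤ) ≤ (Pi.single k 1 : V d) i ∧ (Pi.single k 1 : V d) i ≤ 1 := by
          intro i; by_cases hi : i = k
          · subst hi; simp
          · simp [hi]
        have hvi : ∀ i, v i = w i + (Pi.single k 1 : V d) i := fun i => congrFun hk i
        have hwm : w ∈ Finset.Icc (0 : V d) (fun _ => (n : ℤ)) := by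
          rw [Finset.mem_Icc, Pi.le_def, Pi.le_def]
          constructor
          · intro i; have := hlo i; have := hsg i; have := hvi i; simp only [Pi.zero_apply]; omega
          · intro i; have := hhi i; have := hsg i; have := hvi i; omega
        have hs2 := edgeOpen_symm hstep
        rw [hk] at hs2
        refine ⟨Relation.ReflTransGen.tail ih1
          ⟨(⟨w, hwm⟩, k), edgeOpen_mkE.mp hs2, Or.inr ⟨rfl, hk.symm⟩⟩, ?_⟩
        rw [Finset.mem_Icc] at hwm ⊢
        exact ⟨hwm.1, hwm.2.trans fun i => by simp⟩
  exact (Finset.finite_toSet _).subset fun v hv => (key v hv).2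

theorem Dis_gD (n : ℕ) (ω : Config d) (e : BoxE d n) (h : ω ∈ Dis (bs n e) (bt n e)) :
    gD (bs n) (bt n) (bdry d n) (fun e => ω (bι n e)) e := by
  obtain ⟨h1, h2, h3⟩ := h
  obtain ⟨⟨x, hx⟩, k⟩ := e
  have hx' := Finset.mem_Icc.mp hx
  rw [Pi.le_def, Pi.le_def] at hx'
  have hsg : ∀ i, (0:ℤ) ≤ (Pi.single k 1 : V d) i ∧ (Pi.single k 1 : V d) i ≤ 1 := by
    intro i; by_cases hi : i = k
    · subst hi; simp
    · simp [hi]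
  refine ⟨?_, fun hc => h3 (gconn_lconn n ω hc), inf_bdry n ω ?_ h1, inf_bdry n ω ?_ h2⟩
  · by_contra hc
    rw [Bool.not_eq_false] at hc
    exact h3 (Relation.ReflTransGen.single (edgeOpen_mkE.mpr hc))
  · rw [Finset.mem_Icc, Pi.le_def, Pi.le_def]
    exact ⟨hx'.1, fun i => by have := hx'.2 i; simp only [bs]; omega⟩
  · rw [Finset.mem_Icc, Pi.le_def, Pi.le_def]
    constructor
    · intro i; have := hx'.1 i; have := hsg i
      simp only [bt, Pi.add_apply, Pi.zero_apply] at *; omega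
    · intro i; have := hx'.2 i; have := hsg i
      simp only [bt, Pi.add_apply] at *; omega

theorem Dis_transl (p : ℝ) (k : Fin d) (x : V d) :
    perc d p (Dis x (x + Pi.single k 1)) = perc d p (Dis 0 (Pi.single k 1)) := by
  rw [← (perc_sh p x).measure_preimage (meas_Dis 0 (Pi.single k 1)).nullMeasurableSet, Dis_sh,
    zero_add, add_comm]

open Classical in
theorem Dis_le (n : ℕ) {p : ℝ} (h0 : 0 ≤ p) (h1 : p ≤ 1) (e : BoxE d n) :
    (perc d p (Dis 0 (Pi.single e.2 1))).toReal ≤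
      ∑ η : BoxE d n → Bool,
        gW p η * (if gD (bs n) (bt n) (bdry d n) η e then (1:ℝ) else 0) := by
  rw [← Dis_transl p e.2 e.1.1]
  have hsub : Dis e.1.1 (e.1.1 + Pi.single e.2 1) ⊆
      ⋃ η ∈ Finset.univ.filter (fun η => gD (bs n) (bt n) (bdry d n) η e),
        {ω : Config d | ∀ f, ω (bι n f) = η f} := by
    intro ω hω
    simp only [Set.mem_iUnion]
    refine ⟨fun f => ω (bι n f), ?_, fun f => rfl⟩
    rw [Finset.mem_filter]
    exact ⟨Finset.mem_univ _, Dis_gD n ω e hω⟩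
  have hle : perc d p (Dis e.1.1 (e.1.1 + Pi.single e.2 1)) ≤
      ENNReal.ofReal (∑ η ∈ Finset.univ.filter
        (fun η : BoxE d n → Bool => gD (bs n) (bt n) (bdry d n) η e), gW p η) := by
    refine (measure_mono hsub).trans ((measure_biUnion_finset_le _ _).trans ?_)
    rw [ENNReal.ofReal_sum_of_nonneg fun η _ => gW_nonneg h0 h1 η]
    exact Finset.sum_le_sum fun η _ => (perc_cyl (bι n) (bι_inj n) h0 h1 η).le
  refine (ENNReal.toReal_mono ENNReal.ofReal_ne_top hle).trans ?_
  rw [ENNReal.toReal_ofReal (Finset.sum_nonneg fun η _ => gW_nonneg h0 h1 η), Finset.sum_filter]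
  refine Finset.sum_le_sum fun η _ => ?_
  split_ifs <;> simp

theorem card_BoxE (n : ℕ) : (Fintype.card (BoxE d n) : ℝ) = ((n : ℝ) + 1) ^ d * d := by
  rw [Fintype.card_prod, Fintype.card_coe, Pi.card_Icc]
  simp

theorem alpha_bound (n : ℕ) {p δ : ℝ} (h0 : 0 ≤ p) (h1 : p ≤ 1) (hδ : 0 < δ) (hδ1 : δ ≤ 1)
    (k : Fin d) :
    p * (perc d p (Dis 0 (Pi.single k 1))).toReal ≤
      2 * δ * d + (1 / δ) * ((((n : ℝ) + 2) / (n + 1)) ^ d - ((n : ℝ) / (n + 1)) ^ d) := by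
  classical
  have h := two_arm (bs (d := d) n) (bt n) (bdry d n) h0 h1 hδ hδ1
  rw [card_bdry, card_BoxE] at h
  set α := (perc d p (Dis 0 (Pi.single k 1))).toReal with hα
  have hpos : (0:ℝ) < ((n : ℝ) + 1) ^ d := by positivity
  have hsum : ((n : ℝ) + 1) ^ d * α ≤ ∑ e : BoxE d n, ∑ η : BoxE d n → Bool,
      gW p η * (if gD (bs n) (bt n) (bdry d n) η e then (1:ℝ) else 0) := by
    rw [Fintype.sum_prod_type]
    have hc : ((n : ℝ) + 1) ^ d * α =
        ∑ x : (Finset.Icc (0 : V d) (fun _ => (n : ℤ))), α := by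
      rw [Finset.sum_const, Finset.card_univ, Fintype.card_coe, Pi.card_Icc]
      simp
    rw [hc]
    refine Finset.sum_le_sum fun x _ => ?_
    refine (Dis_le n h0 h1 (x, k)).trans ?_
    refine Finset.single_le_sum (f := fun j => ∑ η : BoxE d n → Bool,
      gW p η * (if gD (bs n) (bt n) (bdry d n) η (x, j) then (1:ℝ) else 0)) ?_ (Finset.mem_univ k)
    intro j _
    refine Finset.sum_nonneg fun η _ => mul_nonneg (gW_nonneg h0 h1 η) ?_
    split_ifs <;> norm_num
  have h2 := (mul_le_mul_of_nonneg_left hsum h0).trans h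
  rw [div_pow, div_pow, ← sub_div]
  have h3 : 2 * δ * d + 1 / δ * ((((n : ℝ) + 2) ^ d - (n : ℝ) ^ d) / ((n : ℝ) + 1) ^ d) =
      (2 * δ * (((n : ℝ) + 1) ^ d * d) + 1 / δ * (((n : ℝ) + 2) ^ d - (n : ℝ) ^ d)) /
        ((n : ℝ) + 1) ^ d := by
    field_simp
  rw [h3, le_div_iff₀ hpos]
  calc p * α * ((n : ℝ) + 1) ^ d = p * (((n : ℝ) + 1) ^ d * α) := by ring
    _ ≤ _ := h2

theorem Dis_zero_single {p : ℝ} (h0 : 0 < p) (h1 : p ≤ 1) (k : Fin d) :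
    perc d p (Dis 0 (Pi.single k 1)) = 0 := by
  set α := (perc d p (Dis 0 (Pi.single k 1))).toReal with hα
  have hlim : Tendsto (fun n : ℕ => (((n : ℝ) + 2) / (n + 1)) ^ d - ((n : ℝ) / (n + 1)) ^ d)
      atTop (𝓝 0) := by
    have t0 : Tendsto (fun n : ℕ => 1 / ((n : ℝ) + 1)) atTop (𝓝 0) :=
      tendsto_one_div_add_atTop_nhds_zero_nat
    have t1 : Tendsto (fun n : ℕ => (1 + 1 / ((n : ℝ) + 1)) ^ d - (1 - 1 / ((n : ℝ) + 1)) ^ d)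
        atTop (𝓝 ((1 + 0) ^ d - (1 - 0) ^ d)) :=
      ((t0.const_add 1).pow d).sub ((t0.const_sub 1).pow d)
    simp only [add_zero, sub_zero, sub_self] at t1
    refine t1.congr fun n => ?_
    have : ((n : ℝ) + 1) ≠ 0 := by positivity
    congr 2
    · field_simp; ring
    · field_simp; ring
  have hδ : ∀ δ : ℝ, 0 < δ → δ ≤ 1 → p * α ≤ 2 * δ * d := by
    intro δ hδ hδ1
    have t2 := (hlim.const_mul (1 / δ)).const_add (2 * δ * d)
    rw [mul_zero, add_zero] at t2
    exact ge_of_tendsto' t2 fun n => alpha_bound n h0.le h1 hδ hδ1 k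
  have hle : p * α ≤ 0 := by
    have t0 : Tendsto (fun n : ℕ => 1 / ((n : ℝ) + 1)) atTop (𝓝 0) :=
      tendsto_one_div_add_atTop_nhds_zero_nat
    have t2 := (t0.const_mul 2).mul_const (d : ℝ)
    rw [mul_zero, zero_mul] at t2
    refine ge_of_tendsto' t2 fun n => hδ _ (by positivity) ?_
    rw [div_le_one (by positivity)]
    have : (0:ℝ) ≤ n := by positivity
    linarith
  have hα0 : α = 0 := by
    have : 0 ≤ α := ENNReal.toReal_nonneg
    nlinarith
  rw [hα, ENNReal.toReal_eq_zero_iff] at hα0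
  exact hα0.resolve_right (measure_ne_top _ _)

theorem Dis_nbr {p : ℝ} (h0 : 0 < p) (h1 : p ≤ 1) {u w : V d} (h : dist1 u w = 1) :
    perc d p (Dis u w) = 0 := by
  obtain ⟨k, hk | hk⟩ := dist1_eq_one h
  · rw [hk, Dis_transl, Dis_zero_single h0 h1]
  · have hsub : Dis u w ⊆ Dis w (w + Pi.single k 1) := by
      rintro ω ⟨a, b, c⟩
      rw [← hk]
      exact ⟨b, a, fun h => c (lconn_symm h)⟩
    refine measure_mono_null hsub ?_
    rw [Dis_transl, Dis_zero_single h0 h1]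

open Classical in
/-- Opening an edge between `u` and `w` when `w` is not in an infinite cluster. -/
theorem open_edge (ω : Config d) {u w v : V d} (e0 : Edge d) (he0 : e0.1 = s(u, w))
    (hω : ω ∈ Dis u v) (hw : ¬ InInfiniteCluster ω w) :
    Function.update ω e0 true ∈ Dis w v := by
  obtain ⟨hu, hv, huv⟩ := hω
  set ω' := Function.update ω e0 true with hω'
  have hmono : ∀ e, ω e = true → ω' e = true := by
    intro e he
    by_cases hee : e = e0
    · rw [hee, hω', Function.update_self]
    · rw [hω', Function.update_of_ne hee]; exact he
  have hgen : ∀ e : Edge d, e ≠ e0 → ω' e = ω e := fun e he => by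
    rw [hω', Function.update_of_ne he]
  have huw : lconn ω' u w :=
    Relation.ReflTransGen.single ⟨he0 ▸ e0.2, by
      have h5 : (⟨s(u, w), he0 ▸ e0.2⟩ : Edge d) = e0 := Subtype.ext he0.symm
      rw [h5, hω', Function.update_self]⟩
  refine ⟨inf_congr huw (inf_mono hmono hu), inf_mono hmono hv, ?_⟩
  intro hc
  have key : ∀ z, lconn ω' v z → lconn ω v z := by
    intro z hz
    induction hz with
    | refl => exact lconn_refl ω v
    | @tail y z _ hstep ih =>
      obtain ⟨h3, h4⟩ := hstep
      by_cases hee : (⟨s(y, z), h3⟩ : Edge d) = e0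
      · exfalso
        have h5 : s(y, z) = s(u, w) := (congrArg Subtype.val hee).trans he0
        rw [Sym2.eq_iff] at h5
        rcases h5 with ⟨rfl, rfl⟩ | ⟨rfl, rfl⟩
        · exact huv (lconn_symm ih)
        · exact hw (inf_congr ih hv)
      · have h6 : ω' (⟨s(y, z), h3⟩ : Edge d) = ω (⟨s(y, z), h3⟩ : Edge d) :=
          hgen _ hee
        exact Relation.ReflTransGen.tail ih ⟨h3, h6.symm.trans h4⟩
  exact hw (inf_congr (key w (lconn_symm hc)) hv)

theorem Dis_step {p : ℝ} (h0 : 0 < p) (h1 : p ≤ 1) {u w v : V d} (h : dist1 u w = 1)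
    (hw : perc d p (Dis w v) = 0) : perc d p (Dis u v) = 0 := by
  classical
  let e0 : Edge d := ⟨s(u, w), h⟩
  have hsub : Dis u v ⊆ (Dis u w ∪ Dis w v) ∪
      {ω | Function.update ω e0 true ∈ Dis w v} := by
    intro ω hω
    by_cases hi : InInfiniteCluster ω w
    · left
      by_cases hc : lconn ω u w
      · right
        exact ⟨hi, hω.2.1, fun h => hω.2.2 (lconn_trans hc h)⟩
      · left
        exact ⟨hω.1, hi, hc⟩
    · right
      exact open_edge ω e0 rfl hω hi
  refine measure_mono_null hsub ?_
  rw [measure_union_null_iff, measure_union_null_iff]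
  exact ⟨⟨Dis_nbr h0 h1 h, hw⟩, insertion h0 h1 _ _ (meas_Dis w v) hw⟩

theorem lat_induct (N : V d → Prop) (v : V d) (hself : N v)
    (hN : ∀ u w, dist1 u w = 1 → N w → N u) (u : V d) : N u := by
  classical
  have hz : ∀ (k : Fin d) (z : ℤ) (u : V d), N u →
      N (u + Pi.single k z) := by
    intro k z
    induction z using Int.induction_on with
    | zero => intro u hu; simpa using hu
    | succ i ih =>
      intro u hu
      refine hN _ (u + Pi.single k (i : ℤ)) ?_ (ih u hu)
      have := dist1_step (u + Pi.single k (i : ℤ)) k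
      rw [add_assoc, ← Pi.single_add] at this
      rw [← this]
      unfold dist1
      exact Finset.sum_congr rfl fun j _ => by rw [← Int.natAbs_neg, neg_sub]
    | pred i ih =>
      intro u hu
      refine hN _ (u + Pi.single k (-(i : ℤ))) ?_ (ih u hu)
      have := dist1_step (u + Pi.single k (-(i : ℤ) - 1)) k
      rwa [add_assoc, ← Pi.single_add, sub_add_cancel] at this
  have hs : ∀ (z : V d) (s : Finset (Fin d)),
      N (v + ∑ k ∈ s, Pi.single k (z k)) := by
    intro z s
    induction s using Finset.induction_on with
    | empty => simpa using hself
    | insert k s hk ih =>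
      rw [Finset.sum_insert hk, add_comm (Pi.single k (z k) : V d), ← add_assoc]
      exact hz k _ _ ih
  have := hs (u - v) Finset.univ
  rw [Finset.univ_sum_single] at this
  simpa using this

theorem Dis_null {p : ℝ} (h0 : 0 < p) (h1 : p ≤ 1) (u v : V d) : perc d p (Dis u v) = 0 := by
  have hself : perc d p (Dis v v) = 0 := by
    have : (Dis v v : Set (Config d)) = ∅ := by
      ext ω
      simp only [Set.mem_empty_iff_false, iff_false]
      exact fun h => h.2.2 (lconn_refl ω v)
    rw [this, measure_empty]
  exact lat_induct (fun u => perc d p (Dis u v) = 0) v hself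
    (fun u w h hw => Dis_step h0 h1 h hw) u

theorem ae_unique {p : ℝ} (h0 : 0 < p) (h1 : p ≤ 1) :
    ∀ᵐ ω ∂(perc d p), ∀ u v, InInfiniteCluster ω u → InInfiniteCluster ω v → lconn ω u v := by
  rw [ae_all_iff]
  intro u
  rw [ae_all_iff]
  intro v
  have := measure_eq_zero_iff_ae_notMem.mp (Dis_null h0 h1 u v)
  filter_upwards [this] with ω hω hu hv
  by_contra hc
  exact hω ⟨hu, hv, hc⟩

end Uniq

/-! ### The standard coupling and the conclusion -/

section Final

variable {d : ℕ}

/-- i.i.d. uniform variables on the edges. -/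
noncomputable def unif (d : ℕ) : Measure (Edge d → unitInterval) :=
  Measure.infinitePi fun _ : Edge d => (volume : Measure unitInterval)

/-- The configuration at level `p`. -/
noncomputable def lev (p : ℝ) (u : Edge d → unitInterval) : Config d :=
  fun e => decide ((u e : ℝ) ≤ p)

theorem meas_lev (p : ℝ) : Measurable (lev (d := d) p) :=
  measurable_pi_lambda _ fun e => (meas_dec p).comp (measurable_pi_apply e)

theorem map_lev (p : ℝ) : (unif d).map (lev p) = perc d p :=
  Measure.infinitePi_map_pi (fun _ : Edge d => (volume : Measure unitInterval))
    (fun _ => meas_dec p)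

theorem lev_mono {p q : ℝ} (h : p ≤ q) (u : Edge d → unitInterval) (e : Edge d)
    (he : lev p u e = true) : lev q u e = true := by
  simp only [lev, decide_eq_true_eq] at *
  exact he.trans h

theorem theta_mono {p q : ℝ} (h : p ≤ q) :
    perc d p {ω | InInfiniteCluster ω 0} ≤ perc d q {ω | InInfiniteCluster ω 0} := by
  rw [← map_lev p, ← map_lev q, Measure.map_apply (meas_lev p) (meas_inf 0),
    Measure.map_apply (meas_lev q) (meas_inf 0)]
  exact measure_mono fun u hu => inf_mono (lev_mono h u) hu

theorem theta_one (hd : 2 ≤ d) : 0 < perc d 1 {ω | InInfiniteCluster ω 0} := by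
  have huniv : lev (d := d) 1 ⁻¹' {ω | InInfiniteCluster ω 0} = Set.univ := by
    ext u
    simp only [Set.mem_preimage, Set.mem_univ, iff_true]
    change InInfiniteCluster (lev 1 u) 0
    rw [inf_iff]
    let k : Fin d := ⟨0, by omega⟩
    have hstep : ∀ n : ℕ, lconn (lev 1 u) 0 (Pi.single k (n : ℤ)) := by
      intro n
      induction n with
      | zero => simpa using lconn_refl (lev 1 u) (0 : V d)
      | succ n ih =>
        refine Relation.ReflTransGen.tail ih ?_
        have h : (Pi.single k ((n + 1 : ℕ) : ℤ) : V d) = Pi.single k (n : ℤ) + Pi.single k 1 := by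
          rw [← Pi.single_add]; push_cast; rfl
        rw [h, edgeOpen_mkE]
        simp only [lev, decide_eq_true_eq]
        exact (u _).2.2
    refine Set.infinite_of_injective_forall_mem (f := fun n : ℕ => (Pi.single k (n : ℤ) : V d))
      ?_ hstep
    intro a b hab
    have := congrFun hab k
    simpa using this
  have : IsProbabilityMeasure (unif d) := by unfold unif; infer_instance
  rw [← map_lev 1, Measure.map_apply (meas_lev 1) (meas_inf 0), huniv, measure_univ]
  exact zero_lt_one

theorem pc_nonneg (F : BernoulliFamily d) : 0 ≤ pc F :=
  Real.sInf_nonneg fun _ h => h.1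

theorem theta_pos (hd : 2 ≤ d) (F : BernoulliFamily d) {p : ℝ} (hp : pc F < p) :
    0 < perc d p {ω | InInfiniteCluster ω 0} := by
  have hne : {p : ℝ | 0 ≤ p ∧ p ≤ 1 ∧ 0 < F.P p {ω : Config d | InInfiniteCluster ω 0}}.Nonempty :=
    ⟨1, zero_le_one, le_rfl, by rw [F_eq F zero_le_one le_rfl]; exact theta_one hd⟩
  obtain ⟨r, ⟨hr0, hr1, hr⟩, hrp⟩ := exists_lt_of_csInf_lt hne hp
  rw [F_eq F hr0 hr1] at hr
  exact hr.trans_le (theta_mono hrp.le)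

theorem ae_recur (p : ℝ) (x : V d) : ∀ᵐ ω ∂(perc d p), InInfiniteCluster ω 0 →
    ∃ᶠ n : ℕ in atTop, InInfiniteCluster ω (n • x) := by
  have := (perc_sh p x).conservative.ae_mem_imp_frequently_image_mem
    (meas_inf (0 : V d)).nullMeasurableSet
  filter_upwards [this] with ω hω h0
  refine (hω h0).mono fun n hn => ?_
  have h2 := (inf_sh_iter x n ω 0).mp hn
  rwa [zero_add] at h2

theorem DReg_le {ω ω' : Config d} (h : ∀ e, ω e = true → ω' e = true) {x y : V d}
    (hx : InInfiniteCluster ω x) (hy : InInfiniteCluster ω y) (hc : lconn ω x y) :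
    DReg ω' ω' x y ≤ DReg ω ω x y := by
  unfold DReg
  rw [regPoint_of_inf hx, regPoint_of_inf hy, regPoint_of_inf (inf_mono h hx),
    regPoint_of_inf (inf_mono h hy)]
  exact ENNReal.toReal_mono (connected_iff.mpr hc) (chemDist_mono h x y)

end Final

/-- **Monotonicity of the time constant.**
For all `p_c(d) < p ≤ q ≤ 1` and `x ∈ ℤ^d`, `μ_p(x) ≥ μ_q(x)`. -/
theorem statement_3 (d : ℕ) (hd : 2 ≤ d) (F : BernoulliFamily d)
    (μ : ℝ → V d → ℝ)
    (hconv : ∀ p, pc F < p → p ≤ 1 → ASTimeConstant (F.P p) (μ p)) :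
    ∀ p q : ℝ, pc F < p → p ≤ q → q ≤ 1 → ∀ x : V d, μ q x ≤ μ p x := by
  intro p q hp hpq hq x
  have hp0 : 0 < p := (pc_nonneg F).trans_lt hp
  have hp1 : p ≤ 1 := hpq.trans hq
  have hcp := hconv p hp hp1 x
  have hcq := hconv q (hp.trans_le hpq) hq x
  rw [F_eq F hp0.le hp1, ← map_lev p] at hcp
  rw [F_eq F (hp0.le.trans hpq) hq, ← map_lev q] at hcq
  have hun := ae_unique (d := d) hp0 hp1
  have hre := ae_recur p x
  rw [← map_lev p] at hun hre
  have hcp' := ae_of_ae_map (meas_lev p).aemeasurable hcp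
  have hcq' := ae_of_ae_map (meas_lev q).aemeasurable hcq
  have hun' := ae_of_ae_map (meas_lev p).aemeasurable hun
  have hre' := ae_of_ae_map (meas_lev p).aemeasurable hre
  have hpos := theta_pos hd F hp
  rw [← map_lev p, Measure.map_apply (meas_lev p) (meas_inf 0)] at hpos
  have hfreq : ∃ᵐ u ∂(unif d), u ∈ lev (d := d) p ⁻¹' {ω | InInfiniteCluster ω 0} :=
    frequently_ae_mem_iff.mpr hpos.ne'
  obtain ⟨u, hu, h1, h2, h3, h4⟩ :=
    (hfreq.and_eventually (hcp'.and (hcq'.and (hun'.and hre')))).exists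
  refine le_of_tendsto_of_tendsto_of_frequently h2 h1 ?_
  refine (h4 hu).mono fun n hn => ?_
  exact div_le_div_of_nonneg_right (DReg_le (lev_mono hpq u) hu hn (h3 _ _ hu hn))
    (Nat.cast_nonneg n)

end Perco
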